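/- Equality of Stein exponents for i.i.d. and arbitrarily varying alternatives with convex base set. Let ℋ = ℂ^d be a finite-dimensional Hilbert space and 𝒜₁, ℬ₁ ⊆ 𝒟(ℋ) two non-empty closed sets of states, with ℬ₁ convex. Then Stein(𝒜₁^{iid}‖ℬ₁^{iid}) = Stein(𝒜₁^{iid}‖ℬ₁^{av}) = min*_{ρ∈𝒜₁, μ∈𝒫(ℬ₁)} lim_{n→∞} (1/n) D(ρ^{⊗n} ‖ ∫_{ℬ₁} dμ(σ) σ^{⊗n}), where the minimum is restricted to the non-empty set of pairs (ρ,μ) for which the inner limit in n exists, and the minimum is attained. -/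

import Mathlib

open Filter MeasureTheory Topology
open scoped BigOperators Classical ComplexOrder

noncomputable section

namespace QSanov

/-- Matrices representing operators on the single-copy Hilbert space with orthonormal
basis indexed by `ι`. -/
abbrev MatC (ι : Type*) := Matrix ι ι ℂ

/-- Matrices representing operators on the `n`-fold tensor power Hilbert space. -/
abbrev MatN (ι : Type*) (n : ℕ) := Matrix (Fin n → ι) (Fin n → ι) ℂ

instance matMeasurableSpace (m n : Type*) : MeasurableSpace (Matrix m n ℂ) :=
  inferInstanceAs (MeasurableSpace (m → n → ℂ))

/-- A quantum state: a positive semidefinite matrix of trace one. -/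
def IsState {κ : Type*} [Fintype κ] (ρ : Matrix κ κ ℂ) : Prop :=
  ρ.PosSemidef ∧ ρ.trace = 1

/-- Loewner order: `A ≤ B` iff `B - A` is positive semidefinite. -/
def loewnerLE {κ : Type*} [Fintype κ] (A B : Matrix κ κ ℂ) : Prop :=
  (B - A).PosSemidef

/-- The `n`-fold tensor power `ρ^{⊗n}` of a single-copy matrix. -/
def tensorPow {ι : Type*} (ρ : MatC ι) (n : ℕ) : MatN ι n :=
  fun i j => ∏ k, ρ (i k) (j k)

/-- The tensor product `ρ₁ ⊗ ⋯ ⊗ ρ_n` of a family of single-copy matrices. -/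
def tensorProdFam {ι : Type*} {n : ℕ} (ρ : Fin n → MatC ι) : MatN ι n :=
  fun i j => ∏ k, ρ k (i k) (j k)

/-- The tensor product of an `n`-copy matrix and an `m`-copy matrix. -/
def tensorMul {ι : Type*} {n m : ℕ} (ρ : MatN ι n) (σ : MatN ι m) : MatN ι (n + m) :=
  fun i j => ρ (fun t => i (Fin.castAdd m t)) (fun t => j (Fin.castAdd m t)) *
    σ (fun t => i (Fin.natAdd n t)) (fun t => j (Fin.natAdd n t))

/-- Conjugation `U_π ρ U_π†` by the unitary permuting the `n` tensor factors. -/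
def permCopies {ι : Type*} {n : ℕ} (π : Equiv.Perm (Fin n)) (ρ : MatN ι n) : MatN ι n :=
  fun i j => ρ (i ∘ π) (j ∘ π)

/-- Matrix logarithm via functional calculus on the support (eigenvalue `0` is sent
to `0`, since `Real.log 0 = 0`). -/
def matLog {κ : Type*} [Fintype κ] [DecidableEq κ] (A : Matrix κ κ ℂ) : Matrix κ κ ℂ :=
  if hA : A.IsHermitian then
    (hA.eigenvectorUnitary : Matrix κ κ ℂ) *
      (Matrix.diagonal fun i => (Real.log (hA.eigenvalues i) : ℂ)) *
      (star (hA.eigenvectorUnitary : Matrix κ κ ℂ))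
  else 0

/-- Support inclusion `supp ρ ⊆ supp σ`, phrased as inclusion of ranges. -/
def suppLE {κ : Type*} [Fintype κ] [DecidableEq κ] (ρ σ : Matrix κ κ ℂ) : Prop :=
  LinearMap.range (Matrix.toLin' ρ) ≤ LinearMap.range (Matrix.toLin' σ)

/-- Umegaki relative entropy `D(ρ‖σ) = Tr[ρ (log ρ - log σ)]`, equal to `+∞` when
`supp ρ ⊄ supp σ`. -/
def relEnt {κ : Type*} [Fintype κ] [DecidableEq κ] (ρ σ : Matrix κ κ ℂ) : EReal :=
  if suppLE ρ σ then (((ρ * (matLog ρ - matLog σ)).trace.re : ℝ) : EReal) else ⊤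

/-- Relative entropy between two sets of states: `D(𝒜‖ℬ) = inf_{ρ∈𝒜, σ∈ℬ} D(ρ‖σ)`. -/
def relEntSet {κ : Type*} [Fintype κ] [DecidableEq κ] (A B : Set (Matrix κ κ ℂ)) : EReal :=
  ⨅ ρ ∈ A, ⨅ σ ∈ B, relEnt ρ σ

/-- The composite i.i.d. hypothesis `𝒻₁^{⊗n, iid}` built on the base set `F1`. -/
def iidSet {ι : Type*} (F1 : Set (MatC ι)) (n : ℕ) : Set (MatN ι n) :=
  {ρ | ∃ σ ∈ F1, ρ = tensorPow σ n}

/-- The arbitrarily varying hypothesis `𝒻₁^{⊗n, av}` built on the base set `F1`. -/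
def avSet {ι : Type*} (F1 : Set (MatC ι)) (n : ℕ) : Set (MatN ι n) :=
  {ρ | ∃ f : Fin n → MatC ι, (∀ p, f p ∈ F1) ∧ ρ = tensorProdFam f}

/-- Worst-case type II error probability `β_ε(A‖B)` for a threshold `ε` on the
worst-case type I error probability. -/
def typeII {κ : Type*} [Fintype κ] [DecidableEq κ] (A B : Set (Matrix κ κ ℂ)) (ε : ℝ) : ℝ :=
  sInf {b : ℝ | ∃ E : Matrix κ κ ℂ, E.PosSemidef ∧ (1 - E).PosSemidef ∧
    (∀ ρ ∈ A, (ρ * (1 - E)).trace.re ≤ ε) ∧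
    b = sSup {x : ℝ | ∃ σ ∈ B, x = (σ * E).trace.re}}

/-- `- log x`, with value `+∞` for `x ≤ 0`. -/
def negLog (x : ℝ) : EReal := if x ≤ 0 then ⊤ else ((-Real.log x : ℝ) : EReal)

/-- `(1/n : EReal)`. -/
def cFrac (n : ℕ) : EReal := (((n : ℝ)⁻¹ : ℝ) : EReal)

/-- The Stein exponent `Stein(𝒜‖ℬ) = lim_{ε→0⁺} liminf_n -(1/n) log β_ε(𝒜_n‖ℬ_n)`;
since the inner quantity is monotone nondecreasing in `ε`, the limit as `ε → 0⁺`
coincides with the infimum over `ε ∈ (0,1)`. -/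
def steinExponent {ι : Type*} [Fintype ι] [DecidableEq ι]
    (A B : ∀ n : ℕ, Set (MatN ι n)) : EReal :=
  ⨅ ε ∈ Set.Ioo (0 : ℝ) 1,
    Filter.liminf (fun n : ℕ => cFrac n * negLog (typeII (A n) (B n) ε)) Filter.atTop

/-- The mixture `∫ dμ(σ) σ^{⊗n}` of i.i.d. states along a measure `μ` on a set of
states `C` (Bochner integral, computed entrywise). -/
def iidMix {ι : Type*} {C : Set (MatC ι)} (μ : Measure ↥C) (n : ℕ) : MatN ι n :=
  fun i j => ∫ σ, (∏ k, (σ : MatC ι) (i k) (j k)) ∂μ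

/-- The `b`-th block of size `k` of an index of `ℋ^{⊗ mk}`. -/
def blockOf {ι : Type*} {m k : ℕ} (i : Fin (m * k) → ι) (b : Fin m) : Fin k → ι :=
  fun t => i (finProdFinEquiv (b, t))

/-- Replace the blocks in `S` of the index `i` by the values prescribed by `c`. -/
def mergeBlocks {ι : Type*} {m k : ℕ} (S : Finset (Fin m)) (c : Fin m → Fin k → ι)
    (i : Fin (m * k) → ι) : Fin (m * k) → ι :=
  fun p => if (finProdFinEquiv.symm p).1 ∈ S
    then c (finProdFinEquiv.symm p).1 (finProdFinEquiv.symm p).2 else i p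

/-- Entry `(i,j)` of the partial trace of `ρ` over the blocks in `S`
(the remaining blocks being evaluated at `i`, `j`). -/
def blockPartialTrace {ι : Type*} [Fintype ι] {m k : ℕ} (S : Finset (Fin m))
    (ρ : MatN ι (m * k)) (i j : Fin (m * k) → ι) : ℂ :=
  (((Fintype.card ι : ℂ) ^ (k * (m - S.card)))⁻¹) *
    ∑ c : Fin m → Fin k → ι, ρ (mergeBlocks S c i) (mergeBlocks S c j)

/-- The `m`-fold tensor power `(𝒩^δ_ω)^{⊗ m}` of the depolarising channel
`𝒩^δ_ω(X) = (1-δ) X + δ Tr[X] ω`, acting blockwise on blocks of `k` tensor factors. -/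
def blockDepolarize {ι : Type*} [Fintype ι] (δ : ℝ) {k : ℕ} (ω : MatN ι k) (m : ℕ)
    (ρ : MatN ι (m * k)) : MatN ι (m * k) :=
  fun i j => ∑ S : Finset (Fin m),
    (((1 - δ) ^ (m - S.card) * δ ^ S.card : ℝ) : ℂ) *
      ((∏ b ∈ S, ω (blockOf i b) (blockOf j b)) * blockPartialTrace S ρ i j)

/-- The `m`-fold tensor power of a `k`-copy matrix, as an `mk`-copy matrix. -/
def powBlocks {ι : Type*} {k : ℕ} (ρ : MatN ι k) (m : ℕ) : MatN ι (m * k) :=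
  fun i j => ∏ b : Fin m, ρ (blockOf i b) (blockOf j b)

/-- `Tr_{n+1,…,n+k}[ρ (𝟙^{⊗n} ⊗ F)]`, the filtered reduction of an `(n+k)`-copy matrix. -/
def condReduce {ι : Type*} [Fintype ι] {n k : ℕ} (ρ : MatN ι (n + k)) (F : MatN ι k) :
    MatN ι n :=
  fun i j => ∑ a : Fin k → ι, ∑ b : Fin k → ι,
    ρ (Fin.append i a) (Fin.append j b) * F b a

/-- Partial trace over the `k`-th tensor factor. -/
def traceOutAt {ι : Type*} [Fintype ι] {n : ℕ} (k : Fin (n + 1)) (σ : MatN ι (n + 1)) :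
    MatN ι n :=
  fun i j => ∑ a : ι, σ (k.insertNth a i) (k.insertNth a j)

/-- Insert the single-copy state `τ` at position `k` into an `n`-copy matrix. -/
def insertState {ι : Type*} {n : ℕ} (k : Fin (n + 1)) (τ : MatC ι) (σ : MatN ι n) :
    MatN ι (n + 1) :=
  fun i j => τ (i k) (j k) *
    σ (fun t => i (k.succAbove t)) (fun t => j (k.succAbove t))

/-- Product of a state on `A^n` and a state on `B^n`, viewed as a state on
`(ℋ_A ⊗ ℋ_B)^{⊗ n}` (reordering tensor factors implicitly). -/
def prodStateAB {ιA ιB : Type*} {n : ℕ} (α : Matrix (Fin n → ιA) (Fin n → ιA) ℂ)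
    (β : Matrix (Fin n → ιB) (Fin n → ιB) ℂ) : MatN (ιA × ιB) n :=
  fun i j => α (fun k => (i k).1) (fun k => (j k).1) * β (fun k => (i k).2) (fun k => (j k).2)


/-- The set `𝒮_{A^n:B^n}` of separable states across the cut `A^n : B^n`. -/
def sepSet (ιA ιB : Type*) [Fintype ιA] [Fintype ιB] (n : ℕ) : Set (MatN (ιA × ιB) n) :=
  convexHull ℝ {ρ | ∃ α β, IsState α ∧ IsState β ∧ ρ = prodStateAB α β}

/-- Classical relative entropy of two finitely supported output distributions. -/
def clRelEnt {m : ℕ} (P Q : Fin m → ℝ) : EReal :=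
  ∑ x, (if P x = 0 then (0 : EReal) else if Q x = 0 then (⊤ : EReal)
    else ((P x * Real.log (P x / Q x) : ℝ) : EReal))

/-- Measured relative entropy: supremum over all finite POVMs of the classical
relative entropy of the induced outcome distributions. -/
def measuredRelEnt {κ : Type*} [Fintype κ] [DecidableEq κ] (ρ σ : Matrix κ κ ℂ) : EReal :=
  ⨆ (m : ℕ) (E : Fin m → Matrix κ κ ℂ) (_ : ∀ x, (E x).PosSemidef) (_ : ∑ x, E x = 1),
    clRelEnt (fun x => (ρ * E x).trace.re) (fun x => (σ * E x).trace.re)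


/-- Axiom Q.I: there is a full-support free state `τ ∈ 𝒜₁` such that every `𝒜_{mk}`
is stable under blockwise depolarising towards `τ^{⊗k}`. -/
def AxiomQI {ι : Type*} [Fintype ι] [DecidableEq ι] (A : ∀ n : ℕ, Set (MatN ι n)) : Prop :=
  ∃ τ : MatC ι, tensorPow τ 1 ∈ A 1 ∧
    ∀ m k : ℕ, 1 ≤ m → 1 ≤ k → ∀ ρ ∈ A (m * k),
      suppLE ρ (tensorPow τ (m * k)) ∧
      ∀ δ ∈ Set.Icc (0 : ℝ) 1, blockDepolarize δ (tensorPow τ k) m ρ ∈ A (m * k)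

/-- Axiom Q.II: closedness under tensor powers. -/
def AxiomQII {ι : Type*} (A : ∀ n : ℕ, Set (MatN ι n)) : Prop :=
  ∀ m k : ℕ, 1 ≤ m → 1 ≤ k → ∀ ρ ∈ A k, powBlocks ρ m ∈ A (m * k)

/-- Axiom Q.III: closedness under permutations of the tensor factors. -/
def AxiomQIII {ι : Type*} (A : ∀ n : ℕ, Set (MatN ι n)) : Prop :=
  ∀ n : ℕ, ∀ ρ ∈ A n, ∀ π : Equiv.Perm (Fin n), permCopies π ρ ∈ A n

/-- Axiom Q.IV: filtering by Hermitian operators in a neighbourhood of the identity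
is completely `cone(𝒜)`-preserving. -/
def AxiomQIV {ι : Type*} [Fintype ι] [DecidableEq ι] (A : ∀ n : ℕ, Set (MatN ι n)) : Prop :=
  ∀ k : ℕ, 1 ≤ k →
    ∃ V : Set (MatN ι k), V ∈ nhds (1 : MatN ι k) ∧
      ∀ F ∈ V, F.IsHermitian → ∀ n : ℕ, 1 ≤ n → ∀ ρ ∈ A (n + k),
        ∃ (lam : ℝ) (ω : MatN ι n), 0 ≤ lam ∧ ω ∈ A n ∧ condReduce ρ F = (lam : ℂ) • ω

section Basics

lemma PosSemidef.real_smul {κ : Type*} {A : Matrix κ κ ℂ} (hA : A.PosSemidef) {c : ℝ} (hc : 0 ≤ c) :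
    ((c : ℂ) • A).PosSemidef :=
  hA.smul (by exact_mod_cast hc)

variable {κ : Type*} [Fintype κ]

open scoped MatrixOrder Matrix.Norms.L2Operator in
lemma PosSemidef.exists_conjTranspose_mul_self {A : Matrix κ κ ℂ} (hA : A.PosSemidef) :
    ∃ C : Matrix κ κ ℂ, A = C.conjTranspose * C :=
  CStarAlgebra.nonneg_iff_eq_star_mul_self.mp hA.nonneg

lemma trace_mul_re_nonneg {A B : Matrix κ κ ℂ} (hA : A.PosSemidef) (hB : B.PosSemidef) :
    0 ≤ (A * B).trace.re := by
  classical
  obtain ⟨C, rfl⟩ := PosSemidef.exists_conjTranspose_mul_self hA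
  rw [Matrix.mul_assoc, Matrix.trace_mul_comm]
  exact (Complex.le_def.mp (hB.mul_mul_conjTranspose_same C).trace_nonneg).1

lemma trace_mul_re_mono {A B E : Matrix κ κ ℂ} (h : (B - A).PosSemidef) (hE : E.PosSemidef) :
    (A * E).trace.re ≤ (B * E).trace.re := by
  have := trace_mul_re_nonneg h hE
  rw [Matrix.sub_mul, Matrix.trace_sub, Complex.sub_re] at this
  linarith

lemma trace_mul_re_mono_right {A B E : Matrix κ κ ℂ} (h : (B - A).PosSemidef)
    (hE : E.PosSemidef) : (E * A).trace.re ≤ (E * B).trace.re := by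
  rw [Matrix.trace_mul_comm E A, Matrix.trace_mul_comm E B]
  exact trace_mul_re_mono h hE

lemma IsState.norm_apply_le {σ : Matrix κ κ ℂ} (hσ : IsState σ) (i j : κ) : ‖σ i j‖ ≤ 1 := by
  classical
  obtain ⟨hp, ht⟩ := hσ
  have hd : ∀ i, ((σ i i).re : ℝ) ≤ 1 := by
    intro i
    have h1 : (σ.trace).re = 1 := by rw [ht]; simp
    rw [← h1, Matrix.trace, Complex.re_sum]
    exact Finset.single_le_sum (f := fun i => (σ i i).re)
      (fun k _ => (Complex.le_def.mp (hp.diag_nonneg (i := k))).1) (Finset.mem_univ i)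
  obtain ⟨C, rfl⟩ := PosSemidef.exists_conjTranspose_mul_self hp
  have key : ∀ i, ((C.conjTranspose * C) i i).re = ∑ k, ‖C k i‖ ^ 2 := by
    intro i
    rw [Matrix.mul_apply, Complex.re_sum]
    refine Finset.sum_congr rfl fun k _ => ?_
    rw [Matrix.conjTranspose_apply, ← Complex.normSq_eq_norm_sq, Complex.normSq_apply]
    simp
  have h1 := hd i
  have h2 := hd j
  rw [key] at h1 h2
  rw [Matrix.mul_apply]
  calc ‖∑ k, C.conjTranspose i k * C k j‖ ≤ ∑ k, ‖C.conjTranspose i k * C k j‖ :=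
        norm_sum_le _ _
    _ ≤ ∑ k, (‖C k i‖ ^ 2 + ‖C k j‖ ^ 2) / 2 := by
        refine Finset.sum_le_sum fun k _ => ?_
        rw [norm_mul, Matrix.conjTranspose_apply, norm_star]
        nlinarith [sq_nonneg (‖C k i‖ - ‖C k j‖)]
    _ = ((∑ k, ‖C k i‖ ^ 2) + ∑ k, ‖C k j‖ ^ 2) / 2 := by
        rw [← Finset.sum_add_distrib, Finset.sum_div]
    _ ≤ 1 := by linarith

lemma isCompact_of_isClosed_of_isState {A : Set (Matrix κ κ ℂ)} (hA : IsClosed A)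
    (hs : ∀ ρ ∈ A, IsState ρ) : IsCompact A := by
  have hc : IsCompact (Set.pi Set.univ fun _ : κ =>
      Set.pi Set.univ fun _ : κ => Metric.closedBall (0 : ℂ) 1) :=
    isCompact_univ_pi fun _ => isCompact_univ_pi fun _ => isCompact_closedBall 0 1
  refine IsCompact.of_isClosed_subset hc hA fun ρ hρ => ?_
  intro i _ j _
  simpa using (hs ρ hρ).norm_apply_le i j

lemma IsState.trace_mul_re_le_one [DecidableEq κ] {σ E : Matrix κ κ ℂ} (hσ : IsState σ)
    (hE : (1 - E).PosSemidef) : (σ * E).trace.re ≤ 1 := by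
  have := trace_mul_re_mono_right hE hσ.1
  rw [Matrix.mul_one, hσ.2] at this
  simpa using this

end Basics

section Tensor

variable {ι : Type*} {n : ℕ}

lemma tensorPow_eq_tensorProdFam (ρ : MatC ι) (n : ℕ) :
    tensorPow ρ n = tensorProdFam (fun _ : Fin n => ρ) := rfl

lemma tensorProdFam_conjTranspose (A : Fin n → MatC ι) :
    (tensorProdFam A).conjTranspose = tensorProdFam fun k => (A k).conjTranspose := by
  ext i j
  simp [tensorProdFam, Matrix.conjTranspose_apply]

lemma tensorProdFam_one [DecidableEq ι] : tensorProdFam (fun _ : Fin n => (1 : MatC ι)) = 1 := by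
  ext i j
  simp only [tensorProdFam, Matrix.one_apply]
  rw [Finset.prod_ite_zero]
  simp [funext_iff]

lemma tensorProdFam_smul (c : Fin n → ℂ) (A : Fin n → MatC ι) :
    tensorProdFam (fun k => c k • A k) = (∏ k, c k) • tensorProdFam A := by
  ext i j
  simp [tensorProdFam, Finset.prod_mul_distrib]

lemma continuous_tensorPow (n : ℕ) : Continuous fun ρ : MatC ι => tensorPow ρ n := by
  refine continuous_matrix fun i j => ?_
  simp only [tensorPow]
  exact continuous_finsetProd _ fun k _ => continuous_id.matrix_elem _ _

variable [Fintype ι]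

lemma tensorProdFam_mul (A B : Fin n → MatC ι) :
    tensorProdFam A * tensorProdFam B = tensorProdFam fun k => A k * B k := by
  ext i j
  simp only [Matrix.mul_apply, tensorProdFam]
  rw [Finset.prod_univ_sum, Fintype.piFinset_univ]
  simp [Finset.prod_mul_distrib]

lemma trace_tensorProdFam (A : Fin n → MatC ι) :
    (tensorProdFam A).trace = ∏ k, (A k).trace := by
  simp only [Matrix.trace, Matrix.diag, tensorProdFam]
  rw [Finset.prod_univ_sum, Fintype.piFinset_univ]

lemma tensorProdFam_posSemidef {A : Fin n → MatC ι} (hA : ∀ k, (A k).PosSemidef) :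
    (tensorProdFam A).PosSemidef := by
  classical
  choose C hC using fun k => PosSemidef.exists_conjTranspose_mul_self (hA k)
  have : tensorProdFam A = (tensorProdFam C).conjTranspose * tensorProdFam C := by
    rw [tensorProdFam_conjTranspose, tensorProdFam_mul]
    congr 1
    funext k
    exact hC k
  rw [this]
  exact Matrix.posSemidef_conjTranspose_mul_self _

lemma isState_tensorProdFam {A : Fin n → MatC ι} (hA : ∀ k, IsState (A k)) :
    IsState (tensorProdFam A) :=
  ⟨tensorProdFam_posSemidef fun k => (hA k).1, by
    rw [trace_tensorProdFam]; simp [(hA _).2]⟩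

lemma isState_tensorPow {ρ : MatC ι} (hρ : IsState ρ) (n : ℕ) : IsState (tensorPow ρ n) :=
  isState_tensorProdFam fun _ => hρ

lemma tensorProdFam_mono {A B : Fin n → MatC ι} (hA : ∀ k, (A k).PosSemidef)
    (hAB : ∀ k, (B k - A k).PosSemidef) :
    (tensorProdFam B - tensorProdFam A).PosSemidef := by
  classical
  have h : tensorProdFam B = ∑ S : Finset (Fin n),
      tensorProdFam (fun k => if k ∈ S then A k else B k - A k) := by
    ext i j
    have hB : ∀ k, B k (i k) (j k) = A k (i k) (j k) + (B k - A k) (i k) (j k) := by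
      intro k; simp
    simp only [Matrix.sum_apply, tensorProdFam]
    simp_rw [hB]
    rw [Finset.prod_add, Finset.powerset_univ]
    refine Finset.sum_congr rfl fun S _ => ?_
    rw [← Finset.prod_filter_mul_prod_filter_not Finset.univ (fun k => k ∈ S)]
    congr 1
    · rw [show Finset.univ.filter (fun k => k ∈ S) = S by ext; simp]
      exact Finset.prod_congr rfl fun k hk => by simp [hk]
    · rw [show Finset.univ.filter (fun k => k ∉ S) = Finset.univ \ S by ext; simp]
      exact Finset.prod_congr rfl fun k hk => by
        have : k ∉ S := by simpa using hk
        simp [this]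
  rw [h, ← Finset.add_sum_erase _ _ (Finset.mem_univ (Finset.univ : Finset (Fin n)))]
  simp only [Finset.mem_univ, if_true]
  rw [add_sub_cancel_left]
  refine Matrix.posSemidef_sum _ fun S _ => tensorProdFam_posSemidef fun k => ?_
  by_cases hk : k ∈ S
  · simpa [hk] using hA k
  · simpa [hk] using hAB k

end Tensor

section TypeII

variable {κ : Type*} [Fintype κ] [DecidableEq κ]

lemma typeII_le {A B : Set (Matrix κ κ ℂ)} (hB : ∀ σ ∈ B, IsState σ) {ε b : ℝ}
    {E : Matrix κ κ ℂ} (hE : E.PosSemidef) (hE' : (1 - E).PosSemidef)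
    (hA : ∀ ρ ∈ A, (ρ * (1 - E)).trace.re ≤ ε) (hb : 0 ≤ b)
    (hBE : ∀ σ ∈ B, (σ * E).trace.re ≤ b) : typeII A B ε ≤ b := by
  have hbdd : BddBelow {b : ℝ | ∃ E : Matrix κ κ ℂ, E.PosSemidef ∧ (1 - E).PosSemidef ∧
    (∀ ρ ∈ A, (ρ * (1 - E)).trace.re ≤ ε) ∧
    b = sSup {x : ℝ | ∃ σ ∈ B, x = (σ * E).trace.re}} := by
    refine ⟨0, ?_⟩
    rintro _ ⟨F, hF, -, -, rfl⟩
    refine Real.sSup_nonneg ?_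
    rintro _ ⟨σ, hσ, rfl⟩
    exact trace_mul_re_nonneg (hB σ hσ).1 hF
  refine (csInf_le hbdd ⟨E, hE, hE', hA, rfl⟩).trans ?_
  refine Real.sSup_le ?_ hb
  rintro _ ⟨σ, hσ, rfl⟩
  exact hBE σ hσ

lemma exists_test_of_typeII_lt {A B : Set (Matrix κ κ ℂ)} (hB : ∀ σ ∈ B, IsState σ)
    {ε b : ℝ} (hε : 0 ≤ ε) (h : typeII A B ε < b) :
    ∃ E : Matrix κ κ ℂ, E.PosSemidef ∧ (1 - E).PosSemidef ∧
      (∀ ρ ∈ A, (ρ * (1 - E)).trace.re ≤ ε) ∧ ∀ σ ∈ B, (σ * E).trace.re ≤ b := by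
  have hne : {b : ℝ | ∃ E : Matrix κ κ ℂ, E.PosSemidef ∧ (1 - E).PosSemidef ∧
    (∀ ρ ∈ A, (ρ * (1 - E)).trace.re ≤ ε) ∧
    b = sSup {x : ℝ | ∃ σ ∈ B, x = (σ * E).trace.re}}.Nonempty := by
    refine ⟨_, 1, Matrix.PosSemidef.one, ?_, ?_, rfl⟩
    · rw [sub_self]; exact Matrix.PosSemidef.zero
    · intro ρ _
      simpa using hε
  obtain ⟨_, ⟨E, hE, hE', hA, rfl⟩, hlt⟩ := exists_lt_of_csInf_lt hne h
  have hbdd : BddAbove {x : ℝ | ∃ σ ∈ B, x = (σ * E).trace.re} := by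
    refine ⟨1, ?_⟩
    rintro _ ⟨τ, hτ, rfl⟩
    exact (hB τ hτ).trace_mul_re_le_one hE'
  exact ⟨E, hE, hE', hA, fun σ hσ => (le_csSup hbdd ⟨σ, hσ, rfl⟩).trans hlt.le⟩

lemma coe_le_cFrac_mul_negLog_iff {n : ℕ} (hn : 0 < n) (R b : ℝ) :
    (R : EReal) ≤ cFrac n * negLog b ↔ b ≤ Real.exp (-(n * R)) := by
  have hn' : (0 : ℝ) < n := by exact_mod_cast hn
  unfold cFrac negLog
  split_ifs with hb
  · rw [EReal.coe_mul_top_of_pos (inv_pos.mpr hn')]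
    simp only [le_top, true_iff]
    exact hb.trans (Real.exp_pos _).le
  · push Not at hb
    rw [← EReal.coe_mul, EReal.coe_le_coe_iff, ← Real.log_le_iff_le_exp hb,
      inv_mul_eq_div, le_div_iff₀ hn']
    constructor <;> intro h <;> nlinarith

end TypeII

section Stein

variable {ι : Type*} [Fintype ι] [DecidableEq ι]

lemma le_steinExponent {A B : ∀ n : ℕ, Set (MatN ι n)} {R : ℝ}
    (h : ∀ ε ∈ Set.Ioo (0 : ℝ) 1, ∀ᶠ n : ℕ in atTop,
      typeII (A n) (B n) ε ≤ Real.exp (-(n * R))) : (R : EReal) ≤ steinExponent A B := by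
  refine le_iInf₂ fun ε hε => ?_
  refine le_liminf_of_le (by isBoundedDefault) ?_
  filter_upwards [h ε hε, eventually_gt_atTop 0] with n hn hn0
  exact (coe_le_cFrac_mul_negLog_iff hn0 _ _).mpr hn

lemma eventually_typeII_le {A B : ∀ n : ℕ, Set (MatN ι n)} {R : ℝ}
    (h : (R : EReal) < steinExponent A B) {ε : ℝ} (hε : ε ∈ Set.Ioo (0 : ℝ) 1) :
    ∀ᶠ n : ℕ in atTop, typeII (A n) (B n) ε ≤ Real.exp (-(n * R)) := by
  have h1 : (R : EReal) <
      liminf (fun n : ℕ => cFrac n * negLog (typeII (A n) (B n) ε)) atTop :=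
    h.trans_le (iInf₂_le ε hε)
  filter_upwards [eventually_lt_of_lt_liminf h1, eventually_gt_atTop 0] with n hn hn0
  exact (coe_le_cFrac_mul_negLog_iff hn0 _ _).mp hn.le

lemma eventually_le_exp_mul (C : ℝ) {δ : ℝ} (hδ : 0 < δ) :
    ∀ᶠ n : ℕ in atTop, C ≤ Real.exp (n * δ) :=
  (Real.tendsto_exp_atTop.comp
    (tendsto_natCast_atTop_atTop.atTop_mul_const hδ)).eventually_ge_atTop C

/-- Comparison of Stein exponents for two alternatives whose error probabilities agree up to
subexponential factors. -/
lemma steinExponent_le_of_subexp {A B B' : ∀ n : ℕ, Set (MatN ι n)}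
    (h : ∀ δ : ℝ, 0 < δ → ∃ C : ℝ, 0 < C ∧ ∀ ε ∈ Set.Ioo (0 : ℝ) 1, ∀ᶠ n : ℕ in atTop,
      ∀ b, typeII (A n) (B n) ε < b →
      typeII (A n) (B' n) ε ≤ C * Real.exp (n * δ) * b) :
    steinExponent A B ≤ steinExponent A B' := by
  refine EReal.ge_of_forall_gt_iff_ge.mp fun R hR => ?_
  obtain ⟨R', hRR', hR'⟩ := EReal.lt_iff_exists_real_btwn.mp hR
  have hδ : 0 < (R' - R) / 2 := by
    have := EReal.coe_lt_coe_iff.mp hRR'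
    linarith
  obtain ⟨C, hC, hCn⟩ := h _ hδ
  refine le_steinExponent fun ε hε => ?_
  filter_upwards [eventually_typeII_le hR' hε, hCn ε hε,
    eventually_le_exp_mul (2 * C) hδ] with n hn hCn hexp
  have h2 := hCn (2 * Real.exp (-(n * R'))) (by linarith [Real.exp_pos (-(n * R'))])
  refine h2.trans ?_
  calc C * Real.exp (n * ((R' - R) / 2)) * (2 * Real.exp (-(n * R')))
      = (2 * C) * (Real.exp (n * ((R' - R) / 2)) * Real.exp (-(n * R'))) := by ring
    _ ≤ Real.exp (n * ((R' - R) / 2)) * (Real.exp (n * ((R' - R) / 2)) * Real.exp (-(n * R'))) := by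
        gcongr
    _ = Real.exp (-(n * R)) := by
        rw [← Real.exp_add, ← Real.exp_add]
        congr 1
        ring

end Stein

section Net

lemma exists_finset_coord {V : Type*} [AddCommGroup V] [Module ℝ V] [FiniteDimensional ℝ V]
    (B : Set V) : ∃ (t : Finset V) (c : V →ₗ[ℝ] (t → ℝ)), (t : Set V) ⊆ B ∧
      ∀ σ ∈ B, σ = ∑ i : t, c σ i • (i : V) := by
  obtain ⟨b, hbB, hspan, hli⟩ := exists_linearIndependent ℝ B
  have hfin : b.Finite := hli.setFinite
  set t := hfin.toFinset with ht
  have htb : (t : Set V) = b := hfin.coe_toFinset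
  set Φ : (t → ℝ) →ₗ[ℝ] V := Fintype.linearCombination ℝ (fun i : t => (i : V)) with hΦ
  have hrange : LinearMap.range Φ = Submodule.span ℝ B := by
    rw [hΦ, Fintype.range_linearCombination, ← hspan]
    congr 1
    rw [← htb]
    simp
  obtain ⟨g, hg⟩ := Φ.rangeRestrict.exists_rightInverse_of_surjective
    Φ.range_rangeRestrict
  obtain ⟨c, hc⟩ := LinearMap.exists_extend g
  refine ⟨t, c, htb ▸ hbB, fun σ hσ => ?_⟩
  have hmem : σ ∈ LinearMap.range Φ := by
    rw [hrange]; exact Submodule.subset_span hσ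
  have h1 : c σ = g ⟨σ, hmem⟩ := by
    rw [← hc]; rfl
  have h2 := congrArg Subtype.val (LinearMap.congr_fun hg ⟨σ, hmem⟩)
  rw [h1]
  simpa [hΦ, Fintype.linearCombination_apply] using h2.symm

variable {κ : Type*} [Fintype κ]

/-- A closed convex set of states has, for every `η > 0`, a finite subset dominating each of
its members up to a factor `1 + η`. -/
lemma exists_finset_dominating {B : Set (Matrix κ κ ℂ)} (hs : ∀ σ ∈ B, IsState σ)
    (hne : B.Nonempty) (hcl : IsClosed B) (hconv : Convex ℝ B) {η : ℝ} (hη : 0 < η) :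
    ∃ F : Finset (Matrix κ κ ℂ), (F : Set (Matrix κ κ ℂ)) ⊆ B ∧
      ∀ σ ∈ B, ∃ y ∈ F, (((1 + η : ℝ) : ℂ) • y - σ).PosSemidef := by
  obtain ⟨t, c, htB, hc⟩ := exists_finset_coord B
  have hcont : Continuous c := LinearMap.continuous_of_finiteDimensional c
  obtain ⟨σ₁, hσ₁⟩ := hne
  have htne : t.Nonempty := by
    rw [Finset.nonempty_iff_ne_empty]
    rintro rfl
    have h0 := hc σ₁ hσ₁
    have h1 := (hs σ₁ hσ₁).2
    rw [h0] at h1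
    simp at h1
  have hD : (0 : ℝ) < t.card := by exact_mod_cast htne.card_pos
  set τ : Matrix κ κ ℂ := ∑ i ∈ t, ((t.card : ℝ)⁻¹) • i with hτdef
  have hτ : τ ∈ B := hconv.sum_mem (fun _ _ => inv_nonneg.mpr hD.le)
    (by rw [Finset.sum_const, nsmul_eq_mul]; exact mul_inv_cancel₀ hD.ne') (fun i hi => htB hi)
  set y : Matrix κ κ ℂ → Matrix κ κ ℂ := fun σ₀ => ((1 + η)⁻¹ : ℝ) • σ₀ + (η / (1 + η)) • τ
    with hy
  have h1η : 0 < 1 + η := by linarith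
  have hyB : ∀ σ₀ ∈ B, y σ₀ ∈ B := fun σ₀ hσ₀ =>
    hconv hσ₀ hτ (by positivity) (by positivity) (by field_simp)
  have hcomp : IsCompact B := isCompact_of_isClosed_of_isState hcl hs
  set U : Matrix κ κ ℂ → Set (Matrix κ κ ℂ) :=
    fun σ₀ => {σ | ∀ i, |c σ i - c σ₀ i| < η / t.card} with hU
  have hUo : ∀ σ₀ ∈ B, U σ₀ ∈ 𝓝 σ₀ := by
    intro σ₀ _
    have ho : IsOpen (U σ₀) := by
      rw [hU]
      simp only [Set.ofPred_forall]
      refine isOpen_iInter_of_finite fun i => ?_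
      exact isOpen_lt ((((continuous_apply i).comp hcont).sub continuous_const).abs)
        continuous_const
    refine ho.mem_nhds ?_
    show ∀ i, |c σ₀ i - c σ₀ i| < η / t.card
    intro i
    rw [sub_self, abs_zero]
    exact div_pos hη (Nat.cast_pos.mpr (Finset.card_pos.mpr ⟨i, i.2⟩))
  obtain ⟨F₀, hF₀B, hF₀⟩ := hcomp.elim_nhds_subcover U hUo
  refine ⟨F₀.image y, ?_, ?_⟩
  · intro z hz
    obtain ⟨σ₀, hσ₀, rfl⟩ := Finset.mem_image.mp (Finset.mem_coe.mp hz)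
    exact hyB _ (hF₀B _ hσ₀)
  · intro σ hσ
    obtain ⟨σ₀, hσ₀, hσU⟩ := Set.mem_iUnion₂.mp (hF₀ hσ)
    refine ⟨y σ₀, Finset.mem_image_of_mem _ hσ₀, ?_⟩
    have hdiff : ((1 + η : ℝ) : ℂ) • y σ₀ - σ =
        ∑ i : t, (((η / t.card - (c σ i - c σ₀ i) : ℝ)) : ℂ) • (i : Matrix κ κ ℂ) := by
      have e1 : ((1 + η : ℝ) : ℂ) • y σ₀ = σ₀ + η • τ := by
        rw [Complex.coe_smul, hy]
        simp only [smul_add, smul_smul]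
        rw [mul_inv_cancel₀ h1η.ne', one_smul, mul_div_cancel₀ _ h1η.ne']
      have e2 : η • τ = ∑ i : t, (η / t.card) • (i : Matrix κ κ ℂ) := by
        rw [hτdef, Finset.smul_sum, ← Finset.sum_coe_sort t]
        exact Finset.sum_congr rfl fun i _ => by rw [smul_smul, div_eq_mul_inv]
      rw [e1, e2]
      conv_lhs => rw [hc σ hσ, hc σ₀ (hF₀B _ hσ₀)]
      rw [← Finset.sum_add_distrib, ← Finset.sum_sub_distrib]
      refine Finset.sum_congr rfl fun i _ => ?_
      rw [Complex.coe_smul]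
      module
    rw [hdiff]
    refine Matrix.posSemidef_sum _ fun i _ => PosSemidef.real_smul (hs _ (htB i.2)).1 ?_
    have := (abs_lt.mp (hσU i)).2
    linarith

end Net

section Mixtures

variable {ι : Type*} [Fintype ι] {B : Set (MatC ι)}

lemma integrable_prod_entries (hs : ∀ σ ∈ B, IsState σ) (μ : Measure ↥B) [IsFiniteMeasure μ]
    {n : ℕ} (i j : Fin n → ι) :
    Integrable (fun σ : ↥B => ∏ k, (σ : MatC ι) (i k) (j k)) μ := by
  refine Integrable.of_bound (C := 1) (Measurable.aestronglyMeasurable ?_) (ae_of_all _ fun σ => ?_)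
  · refine Finset.measurable_fun_prod _ fun k _ => ?_
    exact (measurable_pi_apply (j k)).comp ((measurable_pi_apply (i k)).comp measurable_subtype_coe)
  · rw [norm_prod]
    exact Finset.prod_le_one (fun _ _ => norm_nonneg _) fun k _ => (hs σ σ.2).norm_apply_le _ _

lemma trace_iidMix_mul (hs : ∀ σ ∈ B, IsState σ) (μ : Measure ↥B) [IsFiniteMeasure μ] {n : ℕ}
    (E : MatN ι n) :
    Integrable (fun σ : ↥B => (tensorPow (σ : MatC ι) n * E).trace) μ ∧
    (iidMix μ n * E).trace = ∫ σ : ↥B, (tensorPow (σ : MatC ι) n * E).trace ∂μ := by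
  have h : ∀ i j : Fin n → ι, Integrable (fun σ : ↥B => tensorPow (σ : MatC ι) n i j * E j i) μ :=
    fun i j => (integrable_prod_entries hs μ i j).mul_const _
  simp only [Matrix.trace, Matrix.diag, Matrix.mul_apply]
  refine ⟨integrable_finsetSum _ fun i _ => integrable_finsetSum _ fun j _ => h i j, ?_⟩
  rw [integral_finsetSum _ fun i _ => integrable_finsetSum _ fun j _ => h i j]
  refine Finset.sum_congr rfl fun i _ => ?_
  rw [integral_finsetSum _ fun j _ => h i j]
  refine Finset.sum_congr rfl fun j _ => ?_
  rw [integral_mul_const]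
  rfl

lemma trace_iidMix_mul_re (hs : ∀ σ ∈ B, IsState σ) (μ : Measure ↥B) [IsFiniteMeasure μ] {n : ℕ}
    (E : MatN ι n) :
    (iidMix μ n * E).trace.re = ∫ σ : ↥B, (tensorPow (σ : MatC ι) n * E).trace.re ∂μ := by
  obtain ⟨h1, h2⟩ := trace_iidMix_mul hs μ E
  rw [h2]
  exact (integral_re h1).symm

lemma iidMix_posSemidef (hs : ∀ σ ∈ B, IsState σ) (μ : Measure ↥B) [IsFiniteMeasure μ] (n : ℕ) :
    (iidMix μ n).PosSemidef := by
  have hH : (iidMix μ n).IsHermitian := by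
    ext i j
    rw [Matrix.conjTranspose_apply]
    simp only [iidMix]
    rw [← starRingEnd_apply, ← integral_conj]
    refine integral_congr_ae (ae_of_all _ fun σ => ?_)
    have := ((isState_tensorPow (hs σ σ.2) n).1.isHermitian).apply i j
    simpa [tensorPow] using this
  refine Matrix.PosSemidef.of_dotProduct_mulVec_nonneg hH fun x => ?_
  have hq : ∀ M : MatN ι n, star x ⬝ᵥ M.mulVec x = (M * Matrix.vecMulVec x (star x)).trace := by
    intro M
    rw [Matrix.mul_vecMulVec, Matrix.trace_vecMulVec, dotProduct_comm]
  rw [Complex.le_def]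
  constructor
  · rw [hq, trace_iidMix_mul_re hs μ]
    refine integral_nonneg fun σ => ?_
    exact trace_mul_re_nonneg (isState_tensorPow (hs σ σ.2) n).1
      (Matrix.posSemidef_vecMulVec_self_star x)
  · exact (hH.im_star_dotProduct_mulVec_self x).symm

lemma isState_iidMix (hs : ∀ σ ∈ B, IsState σ) (μ : Measure ↥B) [IsProbabilityMeasure μ] (n : ℕ) :
    IsState (iidMix μ n) := by
  classical
  refine ⟨iidMix_posSemidef hs μ n, ?_⟩
  have h := (trace_iidMix_mul hs μ (1 : MatN ι n)).2
  simp only [Matrix.mul_one] at h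
  rw [h]
  simp [(isState_tensorPow (hs _ (Subtype.prop _)) n).2]

lemma iidMix_sub_smul_posSemidef (hs : ∀ σ ∈ B, IsState σ) (μ : Measure ↥B)
    [IsFiniteMeasure μ] (y : ↥B) {a : ℝ} (ha : 0 ≤ a)
    (h : ENNReal.ofReal a • Measure.dirac y ≤ μ) (n : ℕ) :
    (iidMix μ n - (a : ℂ) • tensorPow (y : MatC ι) n).PosSemidef := by
  have hfin : IsFiniteMeasure (ENNReal.ofReal a • Measure.dirac y) :=
    Measure.smul_finite _ ENNReal.ofReal_ne_top
  have hμ : μ = (μ - ENNReal.ofReal a • Measure.dirac y) + ENNReal.ofReal a • Measure.dirac y :=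
    (Measure.sub_add_cancel_of_le h).symm
  set ν := μ - ENNReal.ofReal a • Measure.dirac y with hν
  have hνfin : IsFiniteMeasure ν := by rw [hν]; infer_instance
  have : iidMix μ n - (a : ℂ) • tensorPow (y : MatC ι) n = iidMix ν n := by
    ext i j
    rw [Matrix.sub_apply, Matrix.smul_apply]
    simp only [iidMix]
    rw [hμ, integral_add_measure (integrable_prod_entries hs _ i j)
      (integrable_prod_entries hs _ i j), integral_smul_measure, ENNReal.toReal_ofReal ha,
      integral_dirac' _ _ (Measurable.stronglyMeasurable ?_)]
    · simp [tensorPow]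
    · refine Finset.measurable_fun_prod _ fun k _ => ?_
      exact (measurable_pi_apply (j k)).comp
        ((measurable_pi_apply (i k)).comp measurable_subtype_coe)
  rw [this]
  exact iidMix_posSemidef hs ν n

/-- A single mixing measure dominating all i.i.d. states up to subexponential factors. -/
lemma exists_universal_measure (hs : ∀ σ ∈ B, IsState σ) (hne : B.Nonempty) (hcl : IsClosed B)
    (hconv : Convex ℝ B) :
    ∃ μ : Measure ↥B, IsProbabilityMeasure μ ∧ ∀ δ : ℝ, 0 < δ → ∃ C : ℝ, 0 < C ∧
      ∀ n : ℕ, ∀ σ ∈ B, (((C * Real.exp (n * δ) : ℝ) : ℂ) • iidMix μ n -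
        tensorPow σ n).PosSemidef := by
  choose F hFB hF using fun j : ℕ =>
    exists_finset_dominating hs hne hcl hconv (η := 1 / ((j : ℝ) + 1)) (by positivity)
  obtain ⟨σ₁, hσ₁⟩ := hne
  set T : Set ↥B := {y | ∃ j, (y : MatC ι) ∈ F j} with hT
  have hTc : T.Countable := by
    have : T = ⋃ j, {y : ↥B | (y : MatC ι) ∈ F j} := by ext; simp [hT]
    rw [this]
    exact Set.countable_iUnion fun j =>
      ((F j).finite_toSet.preimage Subtype.val_injective.injOn).countable
  have hTne : T.Nonempty := by
    obtain ⟨y, hy, -⟩ := hF 0 σ₁ hσ₁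
    exact ⟨⟨y, hFB 0 hy⟩, 0, hy⟩
  obtain ⟨y, hy⟩ := hTc.exists_eq_range hTne
  set μ : Measure ↥B := Measure.sum fun i : ℕ =>
    ENNReal.ofReal ((1 / 2 : ℝ) ^ (i + 1)) • Measure.dirac (y i) with hμ
  have hprob : IsProbabilityMeasure μ := by
    constructor
    rw [hμ, Measure.sum_apply _ MeasurableSet.univ]
    simp only [Measure.smul_apply, measure_univ, smul_eq_mul, mul_one]
    rw [← ENNReal.ofReal_tsum_of_nonneg (fun _ => by positivity)]
    · simp_rw [pow_succ]
      rw [tsum_mul_right, tsum_geometric_two]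
      norm_num
    · exact (summable_nat_add_iff 1).mpr summable_geometric_two
  refine ⟨μ, hprob, fun δ hδ => ?_⟩
  obtain ⟨j, hj⟩ := exists_nat_one_div_lt hδ
  have hidx : ∀ z : F j, ∃ i, (y i : MatC ι) = z := by
    intro z
    have : (⟨z, hFB j z.2⟩ : ↥B) ∈ Set.range y := by rw [← hy]; exact ⟨j, z.2⟩
    obtain ⟨i, hi⟩ := this
    exact ⟨i, by rw [hi]⟩
  choose idx hidx using hidx
  set C : ℝ := ∑ z : F j, (2 : ℝ) ^ (idx z + 1) with hC
  have hCpos : 0 < C := by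
    obtain ⟨z, hz, -⟩ := hF j σ₁ hσ₁
    exact Finset.sum_pos (fun _ _ => by positivity) ⟨⟨z, hz⟩, Finset.mem_univ _⟩
  refine ⟨C, hCpos, fun n σ hσ => ?_⟩
  obtain ⟨z, hz, hσz⟩ := hF j σ hσ
  have h1 : ((((1 + 1 / ((j : ℝ) + 1)) ^ n : ℝ) : ℂ) • tensorPow z n -
      tensorPow σ n).PosSemidef := by
    have := tensorProdFam_mono (n := n) (fun _ => (hs σ hσ).1) (fun _ => hσz)
    rw [tensorProdFam_smul] at this
    simpa [tensorPow_eq_tensorProdFam] using this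
  have h2 := iidMix_sub_smul_posSemidef hs μ (y (idx ⟨z, hz⟩))
    (a := (1 / 2 : ℝ) ^ (idx ⟨z, hz⟩ + 1)) (by positivity)
    (Measure.le_sum (fun i : ℕ =>
      ENNReal.ofReal ((1 / 2 : ℝ) ^ (i + 1)) • Measure.dirac (y i)) _) n
  rw [hidx] at h2
  set a : ℝ := (1 + 1 / ((j : ℝ) + 1)) ^ n with ha
  set b : ℝ := (2 : ℝ) ^ (idx ⟨z, hz⟩ + 1) with hb
  have hbpos : 0 < b := by positivity
  have hapos : 0 < a := by positivity
  have hb' : (1 / 2 : ℝ) ^ (idx ⟨z, hz⟩ + 1) = b⁻¹ := by rw [hb, one_div, inv_pow]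
  rw [hb'] at h2
  have hbC : b ≤ C := Finset.single_le_sum (f := fun z : F j => (2 : ℝ) ^ (idx z + 1))
    (fun _ _ => by positivity) (Finset.mem_univ (⟨z, hz⟩ : F j))
  have haexp : a ≤ Real.exp (n * δ) := by
    rw [ha, Real.exp_nat_mul]
    refine pow_le_pow_left₀ (by positivity) ?_ n
    linarith [Real.add_one_le_exp δ]
  have h3 := PosSemidef.real_smul h2 (mul_pos hapos hbpos).le
  have h4 := PosSemidef.real_smul (iidMix_posSemidef hs μ n)
    (c := C * Real.exp (n * δ) - a * b)
    (by nlinarith [mul_le_mul hbC haexp hapos.le hCpos.le])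
  convert (h1.add h3).add h4 using 1
  have e : (((a * b : ℝ) : ℂ)) * ((b⁻¹ : ℝ) : ℂ) = a := by
    rw [← Complex.ofReal_mul]
    congr 1
    field_simp
  rw [smul_sub, smul_smul, e]
  push_cast
  module

end Mixtures

section TypeCounting

lemma eventually_pow_le_exp (c : ℝ) (K : ℕ) {δ : ℝ} (hδ : 0 < δ) :
    ∀ᶠ n : ℕ in atTop, (c * ((n : ℝ) + 1)) ^ K ≤ Real.exp (n * δ) := by
  have h := ((isLittleO_pow_exp_pos_mul_atTop K hδ).comp_tendsto
    (tendsto_natCast_atTop_atTop (R := ℝ))).bound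
    (show (0 : ℝ) < ((2 * |c| + 1) ^ K)⁻¹ by positivity)
  filter_upwards [h, eventually_ge_atTop 1] with n hn hn1
  have hn1' : (1 : ℝ) ≤ n := by exact_mod_cast hn1
  simp only [Function.comp_apply, norm_pow, Real.norm_eq_abs, Real.abs_exp,
    Nat.abs_cast] at hn
  calc (c * ((n : ℝ) + 1)) ^ K ≤ |c * ((n : ℝ) + 1)| ^ K := by
        rw [← abs_pow]; exact le_abs_self _
    _ ≤ ((2 * |c| + 1) * n) ^ K := by
        refine pow_le_pow_left₀ (abs_nonneg _) ?_ K
        rw [abs_mul, abs_of_pos (by positivity : (0 : ℝ) < n + 1)]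
        nlinarith [abs_nonneg c]
    _ = (2 * |c| + 1) ^ K * (n : ℝ) ^ K := mul_pow _ _ _
    _ ≤ (2 * |c| + 1) ^ K * (((2 * |c| + 1) ^ K)⁻¹ * Real.exp (δ * n)) := by gcongr
    _ = Real.exp (n * δ) := by
        rw [mul_inv_cancel_left₀ (by positivity), mul_comm]

lemma factorial_le_exp_mul_pow (m : ℕ) :
    (m.factorial : ℝ) ≤ Real.exp 1 * (m + 1) * ((m : ℝ) ^ m * Real.exp (-m)) := by
  have key : ∀ m : ℕ, ((m + 1).factorial : ℝ) ≤
      ((m : ℝ) + 1) ^ (m + 2) * Real.exp (-m) := by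
    intro m
    induction m with
    | zero => simp
    | succ m ih =>
      have hlog : Real.exp 1 * ((m : ℝ) + 1) ^ (m + 2) ≤ ((m : ℝ) + 2) ^ (m + 2) := by
        have h1 := Real.one_sub_inv_le_log_of_pos
          (show (0 : ℝ) < ((m : ℝ) + 2) / (m + 1) by positivity)
        have h2 : 1 ≤ ((m + 2 : ℕ) : ℝ) * Real.log (((m : ℝ) + 2) / (m + 1)) := by
          refine le_trans (le_of_eq ?_) (mul_le_mul_of_nonneg_left h1 (by positivity))
          push_cast
          field_simp
          ring
        have h3 := Real.exp_le_exp.mpr h2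
        rw [Real.exp_nat_mul, Real.exp_log (by positivity), div_pow,
          le_div_iff₀ (by positivity)] at h3
        exact h3
      have e : Real.exp (-((m + 1 : ℕ) : ℝ)) = Real.exp (-m) * (Real.exp 1)⁻¹ := by
        rw [← Real.exp_neg, ← Real.exp_add]; push_cast; ring_nf
      rw [Nat.factorial_succ, e]
      push_cast
      calc ((m : ℝ) + 1 + 1) * ((m + 1).factorial : ℝ)
          ≤ ((m : ℝ) + 1 + 1) * (((m : ℝ) + 1) ^ (m + 2) * Real.exp (-m)) := by gcongr
        _ = ((m : ℝ) + 2) * (Real.exp 1 * ((m : ℝ) + 1) ^ (m + 2)) *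
            (Real.exp (-m) * (Real.exp 1)⁻¹) := by field_simp; ring
        _ ≤ ((m : ℝ) + 2) * (((m : ℝ) + 2) ^ (m + 2)) *
            (Real.exp (-m) * (Real.exp 1)⁻¹) := by gcongr
        _ = _ := by ring
  cases m with
  | zero => simp
  | succ m =>
    refine (key m).trans (le_of_eq_of_le ?_ (mul_le_mul_of_nonneg_right
      (show Real.exp 1 * ((m : ℝ) + 1) ≤ Real.exp 1 * (((m + 1 : ℕ) : ℝ) + 1) by
        push_cast; gcongr; linarith) (by positivity)))
    have e : Real.exp (-((m + 1 : ℕ) : ℝ)) = Real.exp (-m) * (Real.exp 1)⁻¹ := by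
      rw [← Real.exp_neg, ← Real.exp_add]; push_cast; ring_nf
    rw [e]
    push_cast
    field_simp
    ring

variable {α : Type*} [Fintype α] {n : ℕ}

lemma sum_card_fiber (g : Fin n → α) : ∑ x, Fintype.card {t // g t = x} = n := by
  rw [← Fintype.card_sigma, Fintype.card_congr (Equiv.sigmaFiberEquiv g), Fintype.card_fin]

lemma prod_comp_eq_prod_pow (g : Fin n → α) (p : α → ℝ) :
    ∏ t, p (g t) = ∏ x, p x ^ Fintype.card {t // g t = x} := by
  rw [← Fintype.prod_fiberwise' g p]
  exact Finset.prod_congr rfl fun x _ => by rw [Finset.prod_const, Finset.card_univ]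

/-- The fibres of `π ↦ g ∘ π` have at most `∏ mₓ!` elements. -/
lemma card_comp_perm_le (g g' : Fin n → α) :
    Fintype.card {π : Equiv.Perm (Fin n) // g ∘ π = g'} ≤
      ∏ x, (Fintype.card {t // g t = x}).factorial := by
  rw [← DomMulAct.stabilizer_card g]
  rcases isEmpty_or_nonempty {π : Equiv.Perm (Fin n) // g ∘ π = g'} with h | ⟨⟨π₀, h₀⟩⟩
  · rw [Fintype.card_eq_zero]; exact Nat.zero_le _
  · refine Fintype.card_le_of_injective
      (fun π => ⟨π.1 * π₀⁻¹, ?_⟩) fun π π' h => ?_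
    · funext t
      have h1 := congrFun π.2 (π₀⁻¹ t)
      have h2 := congrFun h₀ (π₀⁻¹ t)
      simp only [Function.comp_apply, Equiv.Perm.coe_mul] at h1 h2 ⊢
      rw [h1, ← h2]
      simp
    · exact Subtype.ext (mul_right_cancel (Subtype.mk.inj h))

/-- The empirical distribution assigns its own type class a probability that is at least
inverse polynomial. -/
lemma le_sum_empirical_mul (g : Fin n → α) (φ : (Fin n → α) → ℝ)
    (hφ : ∀ g, 0 ≤ φ g) (hinv : ∀ g, ∀ π : Equiv.Perm (Fin n), φ (g ∘ π) = φ g) :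
    φ g ≤ (Real.exp 1 * ((n : ℝ) + 1)) ^ Fintype.card α *
      ∑ g', (∏ t, (Fintype.card {s // g s = g' t} : ℝ) / n) * φ g' := by
  set m : α → ℕ := fun x => Fintype.card {s // g s = x} with hm
  set p : α → ℝ := fun x => (m x : ℝ) / n with hp
  have hp0 : ∀ x, 0 ≤ p x := fun x => by positivity
  set F : (Fin n → α) → ℝ := fun g' => (∏ t, p (g' t)) * φ g' with hF
  have hF0 : ∀ g', 0 ≤ F g' := fun g' => mul_nonneg (Finset.prod_nonneg fun _ _ => hp0 _) (hφ _)
  set M : ℕ := ∏ x, (m x).factorial with hM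
  have hcount : (n.factorial : ℝ) * F g ≤ M * ∑ g', F g' := by
    have h1 : ∑ π : Equiv.Perm (Fin n), F (g ∘ π) = n.factorial * F g := by
      have : ∀ π : Equiv.Perm (Fin n), F (g ∘ π) = F g := by
        intro π
        simp only [hF, hinv, Function.comp_apply]
        rw [Equiv.prod_comp π fun t => p (g t)]
      simp [this, Fintype.card_perm]
    rw [← h1, ← Fintype.sum_fiberwise' (fun π : Equiv.Perm (Fin n) => g ∘ π) F, Finset.mul_sum]
    refine Finset.sum_le_sum fun g' _ => ?_
    rw [Finset.sum_const, Finset.card_univ, nsmul_eq_mul]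
    exact mul_le_mul_of_nonneg_right (by exact_mod_cast card_comp_perm_le g g') (hF0 g')
  have hMle : (M : ℝ) ≤ (Real.exp 1 * ((n : ℝ) + 1)) ^ Fintype.card α *
      ((∏ x, (m x : ℝ) ^ m x) * Real.exp (-n)) := by
    have hmn : ∀ x, m x ≤ n := fun x => by
      simpa using Fintype.card_subtype_le (fun s => g s = x)
    have e : Real.exp (-(n : ℝ)) = ∏ x, Real.exp (-(m x : ℝ)) := by
      rw [← Real.exp_sum, Finset.sum_neg_distrib, ← Nat.cast_sum, hm, sum_card_fiber]
    rw [e, ← Finset.prod_mul_distrib, hM, Nat.cast_prod, ← Finset.card_univ,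
      ← Finset.prod_const, ← Finset.prod_mul_distrib]
    refine Finset.prod_le_prod (fun _ _ => by positivity) fun x _ => ?_
    refine (factorial_le_exp_mul_pow (m x)).trans ?_
    have : (m x : ℝ) ≤ n := by exact_mod_cast hmn x
    gcongr
  have hprod : (∏ t, p (g t)) = (∏ x, (m x : ℝ) ^ m x) / (n : ℝ) ^ n := by
    rw [prod_comp_eq_prod_pow]
    simp only [hp, div_pow]
    rw [Finset.prod_div_distrib, Finset.prod_pow_eq_pow_sum, sum_card_fiber]
  have hn : (n : ℝ) ^ n * Real.exp (-n) ≤ n.factorial := by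
    have := Real.pow_div_factorial_le_exp (n : ℝ) (by positivity) n
    rw [div_le_iff₀ (by positivity)] at this
    rw [Real.exp_neg, ← div_eq_mul_inv, div_le_iff₀ (by positivity)]
    linarith
  have hnpos : (0 : ℝ) < (n : ℝ) ^ n := by
    rcases n.eq_zero_or_pos with h | h
    · simp [h]
    · positivity
  set P : ℝ := ∏ x, (m x : ℝ) ^ m x with hP
  have hPpos : 0 < P := Finset.prod_pos fun x _ => by
    rcases (m x).eq_zero_or_pos with h | h
    · simp [h]
    · positivity
  have hS : 0 ≤ ∑ g', F g' := Finset.sum_nonneg fun g' _ => hF0 g'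
  have h2 : P * Real.exp (-n) * φ g ≤
      P * Real.exp (-n) * ((Real.exp 1 * ((n : ℝ) + 1)) ^ Fintype.card α * ∑ g', F g') := by
    calc P * Real.exp (-n) * φ g
        = ((n : ℝ) ^ n * Real.exp (-n)) * F g := by
          simp only [hF]; rw [hprod]; field_simp
      _ ≤ n.factorial * F g := mul_le_mul_of_nonneg_right hn (hF0 g)
      _ ≤ M * ∑ g', F g' := hcount
      _ ≤ _ := mul_le_mul_of_nonneg_right hMle hS
      _ = _ := by ring
  exact le_of_mul_le_mul_left h2 (by positivity)

end TypeCounting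

section Symmetrization

variable {ι : Type*} {n : ℕ}

lemma permCopies_tensorProdFam (π : Equiv.Perm (Fin n)) (A : Fin n → MatC ι) :
    permCopies π (tensorProdFam A) = tensorProdFam (A ∘ π.symm) := by
  ext i j
  simp only [permCopies, tensorProdFam, Function.comp_apply]
  rw [← Equiv.prod_comp π.symm]
  simp

lemma permCopies_posSemidef {E : MatN ι n} (hE : E.PosSemidef) (π : Equiv.Perm (Fin n)) :
    (permCopies π E).PosSemidef :=
  hE.submatrix fun i : Fin n → ι => i ∘ π

lemma permCopies_one [DecidableEq ι] (π : Equiv.Perm (Fin n)) :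
    permCopies π (1 : MatN ι n) = 1 := by
  ext i j
  simp only [permCopies, Matrix.one_apply]
  refine if_congr ⟨fun h => ?_, fun h => h ▸ rfl⟩ rfl rfl
  exact π.surjective.injective_comp_right h

/-- Average of `E` over all permutations of the tensor factors. -/
def symmetrize (E : MatN ι n) : MatN ι n :=
  (((n.factorial : ℝ)⁻¹ : ℝ) : ℂ) • ∑ π : Equiv.Perm (Fin n), permCopies π E

lemma symmetrize_posSemidef {E : MatN ι n} (hE : E.PosSemidef) : (symmetrize E).PosSemidef :=
  PosSemidef.real_smul (Matrix.posSemidef_sum _ fun π _ => permCopies_posSemidef hE π)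
    (by positivity)

lemma one_sub_symmetrize [DecidableEq ι] (E : MatN ι n) :
    1 - symmetrize E = symmetrize (1 - E) := by
  have h : ∀ π : Equiv.Perm (Fin n), permCopies π (1 - E) = 1 - permCopies π E := by
    intro π
    conv_rhs => rw [← permCopies_one π]
    rfl
  simp only [symmetrize, h, Finset.sum_sub_distrib, smul_sub, Finset.sum_const,
    Finset.card_univ, Fintype.card_perm, Fintype.card_fin]
  rw [← Nat.cast_smul_eq_nsmul ℂ, smul_smul]
  push_cast
  rw [inv_mul_cancel₀ (by positivity), one_smul]

lemma tensorPow_sum_smul {α : Type*} [Fintype α] (p : α → ℝ) (y : α → MatC ι) :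
    tensorPow (∑ x, (p x : ℂ) • y x) n =
      ∑ g : Fin n → α, ((∏ t, p (g t) : ℝ) : ℂ) • tensorProdFam (y ∘ g) := by
  ext i j
  simp only [tensorPow, tensorProdFam, Matrix.sum_apply, Matrix.smul_apply, smul_eq_mul]
  rw [Finset.prod_univ_sum, Fintype.piFinset_univ]
  refine Finset.sum_congr rfl fun g _ => ?_
  rw [Finset.prod_mul_distrib]
  push_cast
  rfl

variable [Fintype ι]

lemma trace_mul_permCopies (π : Equiv.Perm (Fin n)) (M E : MatN ι n) :
    (M * permCopies π E).trace = (permCopies π.symm M * E).trace := by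
  simp only [Matrix.trace, Matrix.diag, Matrix.mul_apply, permCopies]
  rw [← Equiv.sum_comp (Equiv.arrowCongr π (Equiv.refl ι))]
  refine Finset.sum_congr rfl fun i _ => ?_
  rw [← Equiv.sum_comp (Equiv.arrowCongr π (Equiv.refl ι))]
  refine Finset.sum_congr rfl fun j _ => ?_
  have h : ∀ i : Fin n → ι, (Equiv.arrowCongr π (Equiv.refl ι)) i = i ∘ π.symm := fun _ => rfl
  have h' : ∀ i : Fin n → ι, (i ∘ π.symm) ∘ π = i := fun i => by
    funext t; simp
  simp only [h, h']

lemma trace_tensorPow_mul_symmetrize (ρ : MatC ι) (E : MatN ι n) :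
    (tensorPow ρ n * symmetrize E).trace = (tensorPow ρ n * E).trace := by
  simp only [symmetrize, Matrix.mul_smul, Matrix.trace_smul, Finset.mul_sum, Matrix.trace_sum,
    trace_mul_permCopies]
  have : ∀ π : Equiv.Perm (Fin n), permCopies π.symm (tensorPow ρ n) = tensorPow ρ n := by
    intro π
    rw [tensorPow_eq_tensorProdFam, permCopies_tensorProdFam]
    rfl
  simp only [this, Finset.sum_const, Finset.card_univ, Fintype.card_perm, Fintype.card_fin,
    nsmul_eq_mul, smul_eq_mul]
  push_cast
  rw [inv_mul_cancel_left₀ (by positivity)]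

lemma trace_tensorProdFam_mul_symmetrize (A : Fin n → MatC ι) (E : MatN ι n)
    (π : Equiv.Perm (Fin n)) :
    (tensorProdFam (A ∘ π) * symmetrize E).trace = (tensorProdFam A * symmetrize E).trace := by
  simp only [symmetrize, Matrix.mul_smul, Matrix.trace_smul, Finset.mul_sum, Matrix.trace_sum,
    trace_mul_permCopies, permCopies_tensorProdFam, Equiv.symm_symm]
  congr 1
  rw [← Equiv.sum_comp (Equiv.mulLeft π)
    (fun τ : Equiv.Perm (Fin n) => (tensorProdFam (A ∘ τ) * E).trace)]
  rfl

lemma trace_tensorProdFam_mul_le {B : Set (MatC ι)} (hs : ∀ σ ∈ B, IsState σ)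
    (hconv : Convex ℝ B) {α : Type*} [Fintype α] {y : α → MatC ι} (hy : ∀ x, y x ∈ B)
    {E : MatN ι n} (hE : E.PosSemidef) (hn : 0 < n) {b : ℝ}
    (hb : ∀ σ ∈ B, (tensorPow σ n * E).trace.re ≤ b) (g : Fin n → α) :
    (tensorProdFam (y ∘ g) * symmetrize E).trace.re ≤
      (Real.exp 1 * ((n : ℝ) + 1)) ^ Fintype.card α * b := by
  have hn' : (0 : ℝ) < n := by exact_mod_cast hn
  have h := le_sum_empirical_mul g
    (fun g => (tensorProdFam (y ∘ g) * symmetrize E).trace.re)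
    (fun g => trace_mul_re_nonneg (tensorProdFam_posSemidef fun t => (hs _ (hy _)).1)
      (symmetrize_posSemidef hE))
    (fun g π => by rw [← Function.comp_assoc, trace_tensorProdFam_mul_symmetrize])
  refine h.trans (mul_le_mul_of_nonneg_left ?_ (by positivity))
  set p : α → ℝ := fun x => (Fintype.card {s // g s = x} : ℝ) / n with hp
  have hmem : ∑ x, (p x : ℂ) • y x ∈ B := by
    have : ∑ x, p x • y x ∈ B := by
      refine hconv.sum_mem (fun x _ => by positivity) ?_ fun x _ => hy x
      simp only [hp]
      rw [← Finset.sum_div, ← Nat.cast_sum, sum_card_fiber, div_self hn'.ne']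
    simpa only [Complex.coe_smul] using this
  refine le_of_eq_of_le ?_ (hb _ hmem)
  rw [← trace_tensorPow_mul_symmetrize, tensorPow_sum_smul, Finset.sum_mul, Matrix.trace_sum,
    Complex.re_sum]
  refine Finset.sum_congr rfl fun g' _ => ?_
  rw [Matrix.smul_mul, Matrix.trace_smul, smul_eq_mul, Complex.re_ofReal_mul]

variable [DecidableEq ι]

lemma steinExponent_avSet_eq_iidSet {A B : Set (MatC ι)} (hB : ∀ σ ∈ B, IsState σ)
    (hne : B.Nonempty) (hcl : IsClosed B) (hconv : Convex ℝ B) :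
    steinExponent (iidSet A) (avSet B) = steinExponent (iidSet A) (iidSet B) := by
  have hav : ∀ n, ∀ σ ∈ avSet B n, IsState σ := by
    rintro n _ ⟨f, hf, rfl⟩
    exact isState_tensorProdFam fun k => hB _ (hf k)
  have hiid : ∀ n, ∀ σ ∈ iidSet B n, IsState σ := by
    rintro n _ ⟨σ, hσ, rfl⟩
    exact isState_tensorPow (hB _ hσ) n
  have hb0 : ∀ {n : ℕ} {E : MatN ι n} {b : ℝ}, E.PosSemidef →
      (∀ σ ∈ iidSet B n, (σ * E).trace.re ≤ b) → 0 ≤ b := by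
    intro n E b hE h
    obtain ⟨σ, hσ⟩ := hne
    exact (trace_mul_re_nonneg (isState_tensorPow (hB _ hσ) n).1 hE).trans (h _ ⟨σ, hσ, rfl⟩)
  refine le_antisymm (steinExponent_le_of_subexp fun δ hδ => ⟨1, one_pos, fun ε hε => ?_⟩)
    (steinExponent_le_of_subexp fun δ hδ => ⟨1, one_pos, fun ε hε => ?_⟩)
  · refine Filter.Eventually.of_forall fun n b hb => ?_
    obtain ⟨E, hE, hE', hEA, hEB⟩ := exists_test_of_typeII_lt (hav n) hε.1.le hb
    have hEB' : ∀ σ ∈ iidSet B n, (σ * E).trace.re ≤ b := by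
      rintro _ ⟨σ, hσ, rfl⟩
      exact hEB _ ⟨fun _ => σ, fun _ => hσ, rfl⟩
    have hb' := hb0 hE hEB'
    refine (typeII_le (hiid n) hE hE' hEA hb' hEB').trans ?_
    have : 1 ≤ Real.exp (n * δ) := Real.one_le_exp (by positivity)
    nlinarith
  · obtain ⟨F, hFB, hF⟩ := exists_finset_dominating hB hne hcl hconv (half_pos hδ)
    filter_upwards [eventually_pow_le_exp (Real.exp 1) (Fintype.card F) (half_pos hδ),
      eventually_gt_atTop 0] with n hn hn0 b hb
    obtain ⟨E, hE, hE', hEA, hEB⟩ := exists_test_of_typeII_lt (hiid n) hε.1.le hb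
    have hb' := hb0 hE hEB
    refine typeII_le (hav n) (symmetrize_posSemidef hE) ?_ ?_ (by positivity) ?_
    · rw [one_sub_symmetrize]; exact symmetrize_posSemidef hE'
    · rintro _ ⟨ρ, hρ, rfl⟩
      rw [one_sub_symmetrize, trace_tensorPow_mul_symmetrize]
      exact hEA _ ⟨ρ, hρ, rfl⟩
    · rintro _ ⟨f, hf, rfl⟩
      choose g hgF hg using fun k => hF (f k) (hf k)
      have h1 := tensorProdFam_mono (fun k => (hB _ (hf k)).1) hg
      have h2 := trace_mul_re_mono h1 (symmetrize_posSemidef hE)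
      rw [tensorProdFam_smul, Matrix.smul_mul, Matrix.trace_smul, Finset.prod_const,
        Finset.card_univ, Fintype.card_fin, ← Complex.ofReal_pow, smul_eq_mul,
        Complex.re_ofReal_mul] at h2
      have h3 := trace_tensorProdFam_mul_le hB hconv (y := fun x : F => (x : MatC ι))
        (fun x => hFB x.2) hE hn0 (b := b) (fun σ hσ => hEB _ ⟨σ, hσ, rfl⟩)
        (fun k => (⟨g k, hgF k⟩ : F))
      have h4 : (1 + δ / 2) ^ n ≤ Real.exp (n * (δ / 2)) := by
        rw [Real.exp_nat_mul]
        refine pow_le_pow_left₀ (by positivity) ?_ n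
        linarith [Real.add_one_le_exp (δ / 2)]
      calc _ ≤ _ := h2
        _ ≤ (1 + δ / 2) ^ n * ((Real.exp 1 * ((n : ℝ) + 1)) ^ Fintype.card F * b) :=
          mul_le_mul_of_nonneg_left h3 (by positivity)
        _ ≤ Real.exp (n * (δ / 2)) * (Real.exp (n * (δ / 2)) * b) := by gcongr
        _ = 1 * Real.exp (n * δ) * b := by
          rw [← mul_assoc, ← Real.exp_add, one_mul]
          congr 2
          ring

end Symmetrization

section Converse

variable {κ : Type*} [Fintype κ] [DecidableEq κ]

lemma trace_diagonal_mul_mul_conjTranspose (f g : κ → ℝ) (Y : Matrix κ κ ℂ) :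
    (Matrix.diagonal (fun i => (f i : ℂ)) *
      (Y * Matrix.diagonal (fun j => (g j : ℂ)) * Y.conjTranspose)).trace.re =
      ∑ i, ∑ j, f i * g j * ‖Y i j‖ ^ 2 := by
  rw [Matrix.trace, Complex.re_sum]
  refine Finset.sum_congr rfl fun i _ => ?_
  rw [Matrix.diag_apply, Matrix.diagonal_mul, Complex.re_ofReal_mul, Matrix.mul_apply,
    Complex.re_sum, Finset.mul_sum]
  refine Finset.sum_congr rfl fun j _ => ?_
  rw [Matrix.mul_diagonal, Matrix.conjTranspose_apply]
  have : Y i j * (g j : ℂ) * star (Y i j) = ((g j * ‖Y i j‖ ^ 2 : ℝ) : ℂ) := by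
    rw [mul_right_comm, Complex.star_def, Complex.mul_conj, Complex.normSq_eq_norm_sq]
    push_cast
    ring
  rw [this, Complex.ofReal_re]
  ring

lemma trace_conj_diagonal_mul_sq {U V F : Matrix κ κ ℂ} (hV : V * V.conjTranspose = 1)
    (hF : F.IsHermitian) (f : κ → ℝ) :
    (U * Matrix.diagonal (fun i => (f i : ℂ)) * U.conjTranspose * (F * F)).trace.re =
      ∑ i, ∑ j, f i * ‖(U.conjTranspose * F * V) i j‖ ^ 2 := by
  have h := trace_diagonal_mul_mul_conjTranspose f (fun _ => 1) (U.conjTranspose * F * V)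
  simp only [mul_one, Complex.ofReal_one, Matrix.diagonal_one, Matrix.conjTranspose_mul,
    Matrix.conjTranspose_conjTranspose, hF.eq] at h
  rw [← h]
  congr 1
  have e : U.conjTranspose * F * V * (V.conjTranspose * (F * U)) =
      U.conjTranspose * (F * F) * U := by
    calc _ = U.conjTranspose * F * (V * V.conjTranspose) * (F * U) := by
          simp only [Matrix.mul_assoc]
      _ = _ := by rw [hV]; simp only [Matrix.mul_one, Matrix.mul_assoc]
  rw [e, Matrix.mul_assoc, Matrix.mul_assoc, Matrix.trace_mul_comm]
  simp only [Matrix.mul_assoc]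

lemma trace_conj_diagonal_mul_conj_diagonal (U V : Matrix κ κ ℂ) (f g : κ → ℝ) :
    (U * Matrix.diagonal (fun i => (f i : ℂ)) * U.conjTranspose *
      (V * Matrix.diagonal (fun j => (g j : ℂ)) * V.conjTranspose)).trace.re =
      ∑ i, ∑ j, f i * g j * ‖(U.conjTranspose * V) i j‖ ^ 2 := by
  rw [← trace_diagonal_mul_mul_conjTranspose, Matrix.conjTranspose_mul,
    Matrix.conjTranspose_conjTranspose, Matrix.mul_assoc, Matrix.mul_assoc,
    Matrix.trace_mul_comm]
  simp only [Matrix.mul_assoc]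

lemma sub_mul_self_posSemidef {F : Matrix κ κ ℂ} (hF : F.PosSemidef)
    (hF' : (1 - F).PosSemidef) : (F - F * F).PosSemidef := by
  have h1 := hF'.mul_mul_conjTranspose_same F
  have h2 := hF.mul_mul_conjTranspose_same (1 - F)
  rw [hF.1.eq] at h1
  rw [hF'.1.eq] at h2
  convert h1.add h2 using 1
  noncomm_ring

lemma eq_conj_diagonal {A : Matrix κ κ ℂ} (hA : A.IsHermitian) :
    A = (hA.eigenvectorUnitary : Matrix κ κ ℂ) *
      Matrix.diagonal (fun i => (hA.eigenvalues i : ℂ)) *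
      (hA.eigenvectorUnitary : Matrix κ κ ℂ).conjTranspose := by
  conv_lhs => rw [hA.spectral_theorem]
  rfl

lemma eigenvectorUnitary_mul_conjTranspose {A : Matrix κ κ ℂ}
    (hA : A.IsHermitian) : (hA.eigenvectorUnitary : Matrix κ κ ℂ) *
      (hA.eigenvectorUnitary : Matrix κ κ ℂ).conjTranspose = 1 :=
  (Matrix.mem_unitaryGroup_iff).mp hA.eigenvectorUnitary.2

lemma conjTranspose_mul_eigenvectorUnitary {A : Matrix κ κ ℂ}
    (hA : A.IsHermitian) : (hA.eigenvectorUnitary : Matrix κ κ ℂ).conjTranspose *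
      (hA.eigenvectorUnitary : Matrix κ κ ℂ) = 1 :=
  (Matrix.mem_unitaryGroup_iff').mp hA.eigenvectorUnitary.2

lemma matLog_eq {A : Matrix κ κ ℂ} (hA : A.IsHermitian) :
    matLog A = (hA.eigenvectorUnitary : Matrix κ κ ℂ) *
      Matrix.diagonal (fun i => (Real.log (hA.eigenvalues i) : ℂ)) *
      (hA.eigenvectorUnitary : Matrix κ κ ℂ).conjTranspose := by
  rw [matLog, dif_pos hA]
  rfl

lemma suppLE_iff_exists_mul {ρ σ : Matrix κ κ ℂ} :
    suppLE ρ σ ↔ ∃ M : Matrix κ κ ℂ, ρ = σ * M := by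
  constructor
  · intro h
    choose w hw using fun j => h ⟨Pi.single j 1, rfl⟩
    refine ⟨Matrix.of fun i j => w j i, ?_⟩
    ext i j
    have := congrFun (hw j) i
    simp only [Matrix.toLin'_apply, Matrix.mulVec_single_one, Matrix.col_apply] at this
    rw [← this]
    rfl
  · rintro ⟨M, rfl⟩ _ ⟨x, rfl⟩
    exact ⟨M.mulVec x, by simp⟩

lemma sum_eigenvalues_mul_norm_sq {ρ U : Matrix κ κ ℂ} (hρ : ρ.IsHermitian)
    (hU : U * U.conjTranspose = 1) :
    ∑ i, ∑ j, hρ.eigenvalues i *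
      ‖((hρ.eigenvectorUnitary : Matrix κ κ ℂ).conjTranspose * U) i j‖ ^ 2 = ρ.trace.re := by
  have := trace_conj_diagonal_mul_sq (U := (hρ.eigenvectorUnitary : Matrix κ κ ℂ)) hU
    Matrix.isHermitian_one hρ.eigenvalues
  rw [← eq_conj_diagonal hρ] at this
  simpa only [Matrix.mul_one] using this.symm

lemma trace_mul_matLog_sub {ρ U : Matrix κ κ ℂ} (hρ : ρ.IsHermitian)
    (hU : U * U.conjTranspose = 1) (g : κ → ℝ) :
    (ρ * (matLog ρ - U * Matrix.diagonal (fun j => (g j : ℂ)) * U.conjTranspose)).trace.re =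
      ∑ i, ∑ j, hρ.eigenvalues i *
        ‖((hρ.eigenvectorUnitary : Matrix κ κ ℂ).conjTranspose * U) i j‖ ^ 2 *
        (Real.log (hρ.eigenvalues i) - g j) := by
  set Z := (hρ.eigenvectorUnitary : Matrix κ κ ℂ) with hZ
  set p := hρ.eigenvalues with hp
  have hZZ' : Z.conjTranspose * Z = 1 := conjTranspose_mul_eigenvectorUnitary hρ
  have key : ∀ (Y : Matrix κ κ ℂ) (g : κ → ℝ),
      (ρ * (Y * Matrix.diagonal (fun j => (g j : ℂ)) * Y.conjTranspose)).trace.re =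
        ∑ i, ∑ j, p i * g j * ‖(Z.conjTranspose * Y) i j‖ ^ 2 := fun Y g => by
    conv_lhs => rw [eq_conj_diagonal hρ]
    exact trace_conj_diagonal_mul_conj_diagonal Z Y p g
  rw [Matrix.mul_sub, Matrix.trace_sub, Complex.sub_re, matLog_eq hρ, key, key, ← hZ, hZZ']
  have hrow : ∀ i, ∑ j, ‖(Z.conjTranspose * U) i j‖ ^ 2 = 1 := by
    intro i
    have := trace_conj_diagonal_mul_sq (U := Z) hU Matrix.isHermitian_one (Pi.single i 1)
    rw [Matrix.mul_one, Matrix.mul_one, Matrix.mul_one, Matrix.trace_mul_comm,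
      ← Matrix.mul_assoc, hZZ', Matrix.one_mul, Matrix.trace_diagonal,
      Finset.sum_eq_single i (fun k _ hk => by simp [Pi.single_eq_of_ne hk])
        (fun h => absurd (Finset.mem_univ _) h),
      Finset.sum_eq_single i (fun k _ hk => by simp [Pi.single_eq_of_ne hk])
        (fun h => absurd (Finset.mem_univ _) h)] at this
    simpa using this.symm
  rw [← Finset.sum_sub_distrib]
  refine Finset.sum_congr rfl fun i _ => ?_
  rw [Finset.sum_eq_single i (fun k _ hk => by simp [Matrix.one_apply_ne' hk])
    (fun h => absurd (Finset.mem_univ _) h)]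
  simp only [mul_sub, Finset.sum_sub_distrib]
  rw [← Finset.sum_mul, ← Finset.mul_sum, hrow i]
  simp only [Matrix.one_apply_eq, norm_one, one_pow, mul_one]
  congr 1
  exact Finset.sum_congr rfl fun j _ => by ring

/-- A state and an alternative with small relative entropy cannot be discriminated well. -/
lemma half_sub_le_of_relEnt_le {ρ σ E : Matrix κ κ ℂ} (hρ : IsState ρ) (hσ : IsState σ)
    (hE : E.PosSemidef) (hE' : (1 - E).PosSemidef) {D t : ℝ} (ht : 0 < t)
    (hD : relEnt ρ σ ≤ D) :
    0 ≤ D + 1 ∧ (1 - (D + 1) / t) / 2 ≤ (ρ * (1 - E)).trace.re + Real.exp t * (σ * E).trace.re := by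
  have hρH := hρ.1.1
  have hσH := hσ.1.1
  set U := (hρH.eigenvectorUnitary : Matrix κ κ ℂ) with hU
  set V := (hσH.eigenvectorUnitary : Matrix κ κ ℂ) with hV
  set p := hρH.eigenvalues with hp
  set q := hσH.eigenvalues with hq
  have hUU : U * U.conjTranspose = 1 := eigenvectorUnitary_mul_conjTranspose hρH
  have hVV : V * V.conjTranspose = 1 := eigenvectorUnitary_mul_conjTranspose hσH
  have hVV' : V.conjTranspose * V = 1 := conjTranspose_mul_eigenvectorUnitary hσH
  have hUU' : U.conjTranspose * U = 1 := conjTranspose_mul_eigenvectorUnitary hρH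
  have hp0 : ∀ i, 0 ≤ p i := hρ.1.eigenvalues_nonneg
  have hq0 : ∀ i, 0 ≤ q i := hσ.1.eigenvalues_nonneg
  have eρ : ρ = U * Matrix.diagonal (fun i => (p i : ℂ)) * U.conjTranspose :=
    eq_conj_diagonal hρH
  have eσ : σ = V * Matrix.diagonal (fun i => (q i : ℂ)) * V.conjTranspose :=
    eq_conj_diagonal hσH
  set X := U.conjTranspose * V with hX
  set P : κ → κ → ℝ := fun i j => p i * ‖X i j‖ ^ 2 with hP
  set Q : κ → κ → ℝ := fun i j => q j * ‖X i j‖ ^ 2 with hQ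
  have hP0 : ∀ i j, 0 ≤ P i j := fun i j => mul_nonneg (hp0 i) (sq_nonneg _)
  have hQ0 : ∀ i j, 0 ≤ Q i j := fun i j => mul_nonneg (hq0 j) (sq_nonneg _)
  have hPsum : ∑ i, ∑ j, P i j = 1 := by
    have := sum_eigenvalues_mul_norm_sq hρH hVV
    rwa [hρ.2, Complex.one_re] at this
  have hXn : ∀ i j, ‖(V.conjTranspose * U) j i‖ = ‖X i j‖ := by
    intro i j
    have : V.conjTranspose * U = X.conjTranspose := by
      rw [hX, Matrix.conjTranspose_mul, Matrix.conjTranspose_conjTranspose]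
    rw [this, Matrix.conjTranspose_apply, norm_star]
  have hQsum : ∑ i, ∑ j, Q i j = 1 := by
    have := trace_conj_diagonal_mul_sq (U := V) hUU Matrix.isHermitian_one q
    rw [← eσ, Matrix.mul_one, Matrix.mul_one, Matrix.mul_one, hσ.2, Finset.sum_comm] at this
    simp only [hXn] at this
    simpa using this.symm
  have hsupp : suppLE ρ σ := by
    by_contra h
    rw [relEnt, if_neg h, top_le_iff] at hD
    exact EReal.coe_ne_top _ hD
  have hPQ : ∀ i j, q j = 0 → P i j = 0 := by
    intro i j hj
    obtain ⟨M, hM⟩ := suppLE_iff_exists_mul.mp hsupp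
    have h0 : ∑ i, P i j = 0 := by
      have h1 := trace_conj_diagonal_mul_conj_diagonal U V p (Pi.single j 1)
      rw [← eρ, hM, Matrix.trace_mul_comm] at h1
      have h2 : V * Matrix.diagonal (fun k => ((Pi.single j 1 : κ → ℝ) k : ℂ)) *
          V.conjTranspose * (σ * M) = 0 := by
        have h3 : Matrix.diagonal (fun k => ((Pi.single j 1 : κ → ℝ) k : ℂ)) *
            Matrix.diagonal (fun i => (q i : ℂ)) = 0 := by
          rw [Matrix.diagonal_mul_diagonal, ← Matrix.diagonal_zero]
          congr 1
          funext k
          by_cases hk : k = j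
          · subst hk; simp [hj]
          · simp [Pi.single_eq_of_ne hk]
        rw [eσ]
        calc _ = V * (Matrix.diagonal (fun k => ((Pi.single j 1 : κ → ℝ) k : ℂ)) *
            (V.conjTranspose * V) * Matrix.diagonal (fun i => (q i : ℂ))) *
              V.conjTranspose * M := by simp only [Matrix.mul_assoc]
          _ = 0 := by rw [hVV', Matrix.mul_one, h3]; simp
      rw [h2] at h1
      simp only [Matrix.trace_zero, Complex.zero_re] at h1
      rw [h1]
      refine Finset.sum_congr rfl fun i _ => ?_
      rw [Finset.sum_eq_single j (fun k _ hk => by simp [Pi.single_eq_of_ne hk])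
        (fun h => absurd (Finset.mem_univ _) h)]
      simp [hP, hX]
    exact (Finset.sum_eq_zero_iff_of_nonneg fun i _ => hP0 i j).mp h0 i (Finset.mem_univ _)
  have hDsum : ∑ i, ∑ j, P i j * (Real.log (p i) - Real.log (q j)) ≤ D := by
    rw [relEnt, if_pos hsupp, EReal.coe_le_coe_iff] at hD
    refine le_of_eq_of_le ?_ hD
    rw [matLog_eq hσH]
    exact (trace_mul_matLog_sub hρH hVV fun j => Real.log (q j)).symm
  set ind : κ → κ → ℝ := fun i j => if p i ≤ Real.exp t * q j then 0 else 1 with hind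
  have hpt : ∀ i j, t * (P i j * ind i j) ≤
      P i j * (Real.log (p i) - Real.log (q j)) + Q i j := by
    intro i j
    rcases (hq0 j).eq_or_lt with hqj | hqj
    · rw [hPQ i j hqj.symm]; simpa using hQ0 i j
    rcases (hp0 i).eq_or_lt with hpi | hpi
    · have : P i j = 0 := by simp [hP, ← hpi]
      rw [this]; simpa using hQ0 i j
    have hlog : Real.log (p i) - Real.log (q j) = Real.log (p i / q j) :=
      (Real.log_div hpi.ne' hqj.ne').symm
    have hneg : 0 ≤ P i j * (Real.log (p i) - Real.log (q j)) + Q i j := by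
      have h1 := Real.one_sub_inv_le_log_of_pos (div_pos hpi hqj)
      rw [← hlog, inv_div] at h1
      have h2 : P i j * (1 - q j / p i) = P i j - Q i j := by
        simp only [hP, hQ]; field_simp
      nlinarith [mul_le_mul_of_nonneg_left h1 (hP0 i j), hP0 i j]
    by_cases hle : p i ≤ Real.exp t * q j
    · simpa [hind, hle] using hneg
    · have h1 : t ≤ Real.log (p i) - Real.log (q j) := by
        rw [hlog, Real.le_log_iff_exp_le (div_pos hpi hqj), le_div_iff₀ hqj]
        exact (not_le.mp hle).le
      simp only [hind, hle, if_false, mul_one]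
      nlinarith [mul_le_mul_of_nonneg_left h1 (hP0 i j), hQ0 i j]
  have hmarkov : t * ∑ i, ∑ j, P i j * ind i j ≤ D + 1 := by
    rw [← hQsum]
    refine le_trans ?_ (add_le_add_left hDsum _)
    rw [← Finset.sum_add_distrib, Finset.mul_sum]
    refine Finset.sum_le_sum fun i _ => ?_
    rw [← Finset.sum_add_distrib, Finset.mul_sum]
    exact Finset.sum_le_sum fun j _ => hpt i j
  have hind0 : ∀ i j, 0 ≤ ind i j := fun i j => by
    simp only [hind]; split_ifs <;> norm_num
  refine ⟨le_trans (mul_nonneg ht.le (Finset.sum_nonneg fun i _ => Finset.sum_nonneg fun j _ =>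
    mul_nonneg (hP0 i j) (hind0 i j))) hmarkov, ?_⟩
  have hI : ∑ i, ∑ j, p i * ‖(U.conjTranspose * (1 - E) * V) i j‖ ^ 2 ≤
      (ρ * (1 - E)).trace.re := by
    rw [← trace_conj_diagonal_mul_sq hVV hE'.1, ← eρ]
    refine trace_mul_re_mono_right (sub_mul_self_posSemidef hE' ?_) hρ.1
    rwa [sub_sub_cancel]
  have hII : ∑ i, ∑ j, q j * ‖(U.conjTranspose * E * V) i j‖ ^ 2 ≤ (σ * E).trace.re := by
    have h1 := trace_mul_re_mono_right (sub_mul_self_posSemidef hE hE') hσ.1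
    refine le_of_eq_of_le ?_ h1
    conv_rhs => rw [eσ]
    rw [trace_conj_diagonal_mul_sq hUU hE.1, Finset.sum_comm]
    refine Finset.sum_congr rfl fun j _ => Finset.sum_congr rfl fun i _ => ?_
    have : V.conjTranspose * E * U = (U.conjTranspose * E * V).conjTranspose := by
      rw [Matrix.conjTranspose_mul, Matrix.conjTranspose_mul, Matrix.conjTranspose_conjTranspose,
        hE.1.eq, Matrix.mul_assoc]
    rw [this, Matrix.conjTranspose_apply, norm_star]
  have hexp : 0 < Real.exp t := Real.exp_pos t
  calc (1 - (D + 1) / t) / 2 ≤ (1 - ∑ i, ∑ j, P i j * ind i j) / 2 := by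
        have : ∑ i, ∑ j, P i j * ind i j ≤ (D + 1) / t := by
          rw [le_div_iff₀ ht]; linarith
        linarith
    _ = ∑ i, ∑ j, P i j * (1 - ind i j) / 2 := by
        rw [show 1 - ∑ i, ∑ j, P i j * ind i j =
          (∑ i, ∑ j, P i j) - ∑ i, ∑ j, P i j * ind i j by rw [hPsum],
          ← Finset.sum_sub_distrib, Finset.sum_div]
        refine Finset.sum_congr rfl fun i _ => ?_
        rw [← Finset.sum_sub_distrib, Finset.sum_div]
        exact Finset.sum_congr rfl fun j _ => by ring
    _ ≤ ∑ i, ∑ j, (p i * ‖(U.conjTranspose * (1 - E) * V) i j‖ ^ 2 +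
          Real.exp t * (q j * ‖(U.conjTranspose * E * V) i j‖ ^ 2)) := by
        refine Finset.sum_le_sum fun i _ => Finset.sum_le_sum fun j _ => ?_
        set a := (U.conjTranspose * (1 - E) * V) i j with ha
        set b := (U.conjTranspose * E * V) i j with hb
        have hab : X i j = a + b := by
          rw [ha, hb, ← Matrix.add_apply, ← Matrix.add_mul, ← Matrix.mul_add,
            sub_add_cancel, Matrix.mul_one]
        by_cases hle : p i ≤ Real.exp t * q j
        · simp only [hind, hle, if_true, sub_zero, mul_one, hP]
          have h1 : ‖X i j‖ ^ 2 ≤ 2 * (‖a‖ ^ 2 + ‖b‖ ^ 2) := by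
            rw [hab]
            have := norm_add_le a b
            nlinarith [sq_nonneg (‖a‖ - ‖b‖), norm_nonneg (a + b), norm_nonneg a, norm_nonneg b]
          nlinarith [mul_le_mul_of_nonneg_left h1 (hp0 i),
            mul_le_mul_of_nonneg_right hle (sq_nonneg ‖b‖)]
        · simp only [hind, hle, if_false, sub_self, mul_zero, zero_div]
          exact add_nonneg (mul_nonneg (hp0 i) (sq_nonneg _))
            (mul_nonneg hexp.le (mul_nonneg (hq0 j) (sq_nonneg _)))
    _ ≤ _ := by
        simp only [Finset.sum_add_distrib, ← Finset.mul_sum]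
        simp only [Finset.mul_sum] at hI hII ⊢
        simp only [← Finset.mul_sum] at hI hII ⊢
        exact add_le_add hI (mul_le_mul_of_nonneg_left hII hexp.le)

end Converse

section ConverseLimit

variable {ι : Type*} [Fintype ι]

lemma le_coe_of_cFrac_mul_lt {n : ℕ} (hn : 0 < n) {x : EReal} {R : ℝ}
    (h : cFrac n * x < R) : x ≤ ((n * R : ℝ) : EReal) := by
  have hn' : (0 : ℝ) < n := by exact_mod_cast hn
  induction x using EReal.rec with
  | bot => exact bot_le
  | top =>
    rw [cFrac, EReal.coe_mul_top_of_pos (inv_pos.mpr hn')] at h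
    exact absurd h not_top_lt
  | coe x =>
    rw [cFrac, ← EReal.coe_mul, EReal.coe_lt_coe_iff, inv_mul_lt_iff₀ hn'] at h
    exact_mod_cast h.le

lemma trace_iidMix_mul_re_le {B : Set (MatC ι)} (hs : ∀ σ ∈ B, IsState σ) (μ : Measure ↥B)
    [IsProbabilityMeasure μ] {n : ℕ} {E : MatN ι n} (hE : E.PosSemidef) {b : ℝ}
    (hb : ∀ σ ∈ B, (tensorPow σ n * E).trace.re ≤ b) : (iidMix μ n * E).trace.re ≤ b := by
  rw [trace_iidMix_mul_re hs]
  refine (integral_mono_of_nonneg (ae_of_all _ fun σ =>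
    trace_mul_re_nonneg (isState_tensorPow (hs _ σ.2) n).1 hE) (integrable_const b)
    (ae_of_all _ fun σ => hb _ σ.2)).trans ?_
  simp

variable [DecidableEq ι]

/-- The regularised relative entropy to any mixture bounds the Stein exponent from above. -/
lemma steinExponent_le_liminf_relEnt {A B : Set (MatC ι)} (hA : ∀ ρ ∈ A, IsState ρ)
    (hB : ∀ σ ∈ B, IsState σ) {ρ : MatC ι} (hρ : ρ ∈ A) (μ : Measure ↥B)
    [IsProbabilityMeasure μ] :
    steinExponent (iidSet A) (iidSet B) ≤
      liminf (fun n : ℕ => cFrac n * relEnt (tensorPow ρ n) (iidMix μ n)) atTop := by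
  have hiid : ∀ n, ∀ σ ∈ iidSet B n, IsState σ := by
    rintro n _ ⟨σ, hσ, rfl⟩
    exact isState_tensorPow (hB _ hσ) n
  refine EReal.ge_of_forall_gt_iff_ge.mp fun R hR => ?_
  refine le_liminf_of_le (by isBoundedDefault) ?_
  rcases lt_or_ge R 0 with hR0 | hR0
  · have h2 : ∀ᶠ n : ℕ in atTop, -R⁻¹ < n :=
      tendsto_natCast_atTop_atTop.eventually_gt_atTop _
    filter_upwards [h2, eventually_gt_atTop 0] with n hn hn0
    by_contra hlt
    have hD := le_coe_of_cFrac_mul_lt hn0 (not_le.mp hlt)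
    have := (half_sub_le_of_relEnt_le (isState_tensorPow (hA _ hρ) n)
      (isState_iidMix hB μ n) (E := 0) Matrix.PosSemidef.zero
      (by rw [sub_zero]; exact Matrix.PosSemidef.one) one_pos hD).1
    have h3 : -R⁻¹ * R = -1 := by rw [neg_mul, inv_mul_cancel₀ hR0.ne]
    nlinarith [mul_lt_mul_of_neg_right hn hR0]
  · obtain ⟨R₁, hRR₁, hR₁⟩ := EReal.lt_iff_exists_real_btwn.mp hR
    obtain ⟨R₂, hRR₂, hR₂⟩ := exists_between (EReal.coe_lt_coe_iff.mp hRR₁)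
    have hR₂0 : 0 < R₂ := hR0.trans_lt hRR₂
    set θ : ℝ := (1 - R / R₂) / 2 with hθ
    have hθ0 : 0 < θ := by
      have : R / R₂ < 1 := (div_lt_one hR₂0).mpr hRR₂
      linarith
    have hθ1 : θ < 1 := by
      have : 0 ≤ R / R₂ := by positivity
      linarith
    have hε : θ / 4 ∈ Set.Ioo (0 : ℝ) 1 := ⟨by linarith, by linarith⟩
    filter_upwards [eventually_typeII_le hR₁ hε, eventually_gt_atTop 0,
      eventually_le_exp_mul (8 / θ) (sub_pos.mpr hR₂),
      tendsto_natCast_atTop_atTop.eventually_ge_atTop (2 / (θ * R₂))] with n hn hn0 hn1 hn2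
    have hn' : (0 : ℝ) < n := by exact_mod_cast hn0
    by_contra hlt
    have hD := le_coe_of_cFrac_mul_lt hn0 (not_le.mp hlt)
    obtain ⟨E, hE, hE', hEA, hEB⟩ := exists_test_of_typeII_lt (hiid n) hε.1.le
      (hn.trans_lt (show _ < 2 * Real.exp (-(n * R₁)) by linarith [Real.exp_pos (-(n * R₁))]))
    have hkey := (half_sub_le_of_relEnt_le (isState_tensorPow (hA _ hρ) n)
      (isState_iidMix hB μ n) hE hE' (t := n * R₂) (by positivity) hD).2
    have h1 := hEA _ ⟨ρ, hρ, rfl⟩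
    have h2 := trace_iidMix_mul_re_le hB μ hE fun σ hσ => hEB _ ⟨σ, hσ, rfl⟩
    have h3 : Real.exp (n * R₂) * (iidMix μ n * E).trace.re ≤ θ / 4 := by
      refine (mul_le_mul_of_nonneg_left h2 (Real.exp_pos _).le).trans ?_
      have e : Real.exp (n * R₂) * (2 * Real.exp (-(n * R₁))) =
          2 / Real.exp (n * (R₁ - R₂)) := by
        rw [mul_left_comm, ← Real.exp_add, div_eq_mul_inv, ← Real.exp_neg]
        congr 2
        ring
      rw [e, div_le_iff₀ (Real.exp_pos _)]
      have := mul_le_mul_of_nonneg_left hn1 hθ0.le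
      rw [mul_div_cancel₀ _ hθ0.ne'] at this
      linarith
    have h4 : (n * R + 1) / (n * R₂) = R / R₂ + 1 / (n * R₂) := by field_simp
    have h5 : 1 / (n * R₂) ≤ θ / 2 := by
      rw [div_le_iff₀ (by positivity)] at hn2 ⊢
      nlinarith
    rw [h4] at hkey
    linarith

end ConverseLimit

section EigenvalueCount

variable {ι : Type*} {k : ℕ}

lemma permCopies_iidMix {B : Set (MatC ι)} (μ : Measure ↥B) (π : Equiv.Perm (Fin k)) :
    permCopies π (iidMix μ k) = iidMix μ k := by
  ext i j
  simp only [permCopies, iidMix, Function.comp_apply]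
  congr 1
  funext σ
  exact Equiv.prod_comp π fun t => (σ : MatC ι) (i t) (j t)

lemma exists_perm_of_card_fiber_eq {α : Type*} (g g' : Fin k → α)
    (h : ∀ x, Fintype.card {t // g t = x} = Fintype.card {t // g' t = x}) :
    ∃ π : Equiv.Perm (Fin k), g' ∘ π = g :=
  ⟨Equiv.ofFiberEquiv fun x => Fintype.equivOfCardEq (h x),
    funext fun t => Equiv.ofFiberEquiv_map _ t⟩

variable [Fintype ι]

lemma permCopies_mul (π : Equiv.Perm (Fin k)) (M N : MatN ι k) :
    permCopies π (M * N) = permCopies π M * permCopies π N :=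
  (Matrix.submatrix_mul_equiv M N (fun i : Fin k → ι => i ∘ π)
    (Equiv.arrowCongr π.symm (Equiv.refl ι)) (fun i : Fin k → ι => i ∘ π)).symm

lemma permCopies_pow [DecidableEq ι] {W : MatN ι k}
    (hW : ∀ π : Equiv.Perm (Fin k), permCopies π W = W) (l : ℕ) (π : Equiv.Perm (Fin k)) :
    permCopies π (W ^ l) = W ^ l := by
  induction l with
  | zero => simp [permCopies_one]
  | succ l ih => rw [pow_succ, permCopies_mul, ih, hW]

/-- A permutation invariant Hermitian matrix has polynomially many distinct eigenvalues. -/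
lemma card_image_eigenvalues_le [DecidableEq ι] {W : MatN ι k} (hH : W.IsHermitian)
    (hW : ∀ π : Equiv.Perm (Fin k), permCopies π W = W) :
    (Finset.univ.image hH.eigenvalues).card ≤ (k + 1) ^ Fintype.card (ι × ι) := by
  rcases isEmpty_or_nonempty (Fin k → ι) with hE | ⟨⟨x₀⟩⟩
  · simp [Finset.univ_eq_empty]
  set T := ι × ι → Fin (k + 1) with hT
  set count : (Fin k → ι × ι) → T := fun g x =>
    ⟨Fintype.card {t // g t = x}, Nat.lt_succ_of_le
      (by simpa using Fintype.card_subtype_le fun t => g t = x)⟩ with hcount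
  have hne : Nonempty (Fin k → ι × ι) := ⟨fun t => (x₀ t, x₀ t)⟩
  set rep : T → (Fin k → ι × ι) := Function.invFun count with hrep
  set v : ℕ → T → ℂ := fun l s =>
    (W ^ l) (fun t => (rep s t).1) (fun t => (rep s t).2) with hv
  have hcard : Fintype.card T = (k + 1) ^ Fintype.card (ι × ι) := by simp [hT]
  have hrel : ∃ c : Fin (Fintype.card T + 1) → ℂ,
      ∑ l, c l • v l = 0 ∧ ∃ l, c l ≠ 0 := by
    by_contra hcon
    push Not at hcon
    have hli : LinearIndependent ℂ fun l : Fin (Fintype.card T + 1) => v l :=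
      Fintype.linearIndependent_iff.mpr hcon
    have := hli.fintype_card_le_finrank
    simp at this
  obtain ⟨c, hc, l₀, hl₀⟩ := hrel
  have hzero : ∑ l, c l • W ^ (l : ℕ) = 0 := by
    ext i j
    set g : Fin k → ι × ι := fun t => (i t, j t) with hg
    have hcg : count (rep (count g)) = count g := Function.invFun_eq ⟨g, rfl⟩
    obtain ⟨π, hπ⟩ := exists_perm_of_card_fiber_eq (rep (count g)) g fun x => by
      convert congrArg Fin.val (congrFun hcg x)
    have hcv := congrFun hc (count g)
    simp only [Finset.sum_apply, Pi.smul_apply, Pi.zero_apply, hv] at hcv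
    rw [Matrix.sum_apply, Matrix.zero_apply, ← hcv]
    refine Finset.sum_congr rfl fun l _ => ?_
    rw [Matrix.smul_apply]
    congr 1
    conv_lhs => rw [← permCopies_pow hW l π]
    rw [← hπ]
    rfl
  set q : Polynomial ℂ := ∑ l : Fin (Fintype.card T + 1),
    Polynomial.C (c l) * Polynomial.X ^ (l : ℕ) with hq
  have hq0 : q ≠ 0 := by
    intro h
    have := congrArg (fun r => Polynomial.coeff r l₀) h
    simp only [hq, Polynomial.finsetSum_coeff, Polynomial.coeff_C_mul, Polynomial.coeff_X_pow,
      Polynomial.coeff_zero] at this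
    rw [Finset.sum_eq_single l₀ (fun l _ hl => by
      rw [if_neg fun h => hl (Fin.ext h.symm), mul_zero])
      (fun h => absurd (Finset.mem_univ _) h)] at this
    simp at this
    exact hl₀ this
  have hdeg : q.natDegree ≤ Fintype.card T := by
    refine Polynomial.natDegree_sum_le_of_forall_le _ _ fun l _ => ?_
    exact (Polynomial.natDegree_C_mul_X_pow_le _ _).trans (Nat.lt_succ_iff.mp l.2)
  have hroot : ∀ i, q.eval (hH.eigenvalues i : ℂ) = 0 := by
    intro i
    have hpow : ∀ l : ℕ, (W ^ l).mulVec (hH.eigenvectorBasis i).ofLp =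
        ((hH.eigenvalues i : ℂ) ^ l) • (hH.eigenvectorBasis i).ofLp := by
      intro l
      induction l with
      | zero => simp
      | succ l ih =>
        have h1 := hH.mulVec_eigenvectorBasis i
        rw [pow_succ, ← Matrix.mulVec_mulVec, h1, Matrix.mulVec_smul, ih, pow_succ', mul_smul]
        rfl
    have h2 := congrArg (fun M => M.mulVec (hH.eigenvectorBasis i).ofLp) hzero
    simp only [Matrix.sum_mulVec, Matrix.smul_mulVec, hpow, Matrix.zero_mulVec] at h2
    simp only [smul_smul, ← Finset.sum_smul] at h2
    have h3 : (hH.eigenvectorBasis i).ofLp ≠ 0 := by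
      intro h
      have h4 := hH.eigenvectorBasis.orthonormal.ne_zero i
      exact h4 (by ext t; exact congrFun h t)
    have h5 := (smul_eq_zero.mp h2).resolve_right h3
    rw [hq, Polynomial.eval_finsetSum, ← h5]
    exact Finset.sum_congr rfl fun l _ => by simp
  calc (Finset.univ.image hH.eigenvalues).card
      = ((Finset.univ.image hH.eigenvalues).image fun x : ℝ => (x : ℂ)).card :=
        (Finset.card_image_of_injective _ Complex.ofReal_injective).symm
    _ ≤ q.roots.toFinset.card := by
        refine Finset.card_le_card fun z hz => ?_
        simp only [Finset.mem_image, Finset.mem_univ, true_and] at hz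
        obtain ⟨_, ⟨i, rfl⟩, rfl⟩ := hz
        rw [Multiset.mem_toFinset, Polynomial.mem_roots hq0]
        exact hroot i
    _ ≤ q.roots.card := Multiset.toFinset_card_le _
    _ ≤ q.natDegree := Polynomial.card_roots' q
    _ ≤ (k + 1) ^ Fintype.card (ι × ι) := hcard ▸ hdeg

end EigenvalueCount

section Pinching

variable {κ : Type*} [Fintype κ] [DecidableEq κ]

lemma conjTranspose_mul_mul_eigenvectorUnitary {A : Matrix κ κ ℂ} (hA : A.IsHermitian) :
    (hA.eigenvectorUnitary : Matrix κ κ ℂ).conjTranspose * A *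
      (hA.eigenvectorUnitary : Matrix κ κ ℂ) =
      Matrix.diagonal fun i => (hA.eigenvalues i : ℂ) := by
  have hu := conjTranspose_mul_eigenvectorUnitary hA
  conv_lhs => enter [1, 2]; rw [eq_conj_diagonal hA]
  simp only [← Matrix.mul_assoc, hu, Matrix.one_mul]
  rw [Matrix.mul_assoc, hu, Matrix.mul_one]

/-- A Hermitian matrix can be diagonalised inside the level sets of a function. -/
lemma exists_block_diagonalizing {A : Matrix κ κ ℂ} (hA : A.IsHermitian) (w : κ → ℝ) :
    ∃ Y : Matrix κ κ ℂ, Y * Y.conjTranspose = 1 ∧ (∀ i j, w i ≠ w j → Y i j = 0) ∧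
      ∀ j l, w j = w l → j ≠ l → (Y.conjTranspose * A * Y) j l = 0 := by
  set H := fun b : ℝ => hA.submatrix (Subtype.val : {i // w i = b} → κ) with hH
  set Q := fun b : ℝ => ((H b).eigenvectorUnitary : Matrix {i // w i = b} {i // w i = b} ℂ)
    with hQ
  set Y : Matrix κ κ ℂ := fun i j => if h : w i = w j then Q (w j) ⟨i, h⟩ ⟨j, rfl⟩ else 0
    with hY
  have hYb : ∀ b, Y.submatrix id (Subtype.val : {i // w i = b} → κ) =
      (1 : Matrix κ κ ℂ).submatrix id (Subtype.val : {i // w i = b} → κ) * Q b := by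
    intro b
    ext i ⟨j, rfl⟩
    have h1 : ((1 : Matrix κ κ ℂ).submatrix id (Subtype.val : {i // w i = w j} → κ) *
        Q (w j)) i ⟨j, rfl⟩ = ∑ s : {i // w i = w j},
          (1 : Matrix κ κ ℂ) i s.1 * Q (w j) s ⟨j, rfl⟩ := rfl
    rw [h1]
    change (if h : w i = w j then Q (w j) ⟨i, h⟩ ⟨j, rfl⟩ else 0) = _
    split_ifs with h
    · rw [Finset.sum_eq_single ⟨i, h⟩, Matrix.one_apply_eq, one_mul]
      · rintro ⟨s, hs⟩ _ hne
        rw [Matrix.one_apply_ne fun h' => hne (Subtype.ext h'.symm), zero_mul]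
      · exact fun h' => absurd (Finset.mem_univ _) h'
    · refine (Finset.sum_eq_zero fun s _ => ?_).symm
      rw [Matrix.one_apply_ne fun h' => h ((congrArg w h').trans s.2), zero_mul]
  have hblock : ∀ (M : Matrix κ κ ℂ) b,
      (Y.conjTranspose * M * Y).submatrix (Subtype.val : {i // w i = b} → κ) Subtype.val =
        (Q b).conjTranspose * M.submatrix Subtype.val Subtype.val * Q b := by
    intro M b
    have h1 : (Y.conjTranspose * M * Y).submatrix (Subtype.val : {i // w i = b} → κ)
        Subtype.val = (Y.submatrix id (Subtype.val : {i // w i = b} → κ)).conjTranspose * M *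
          Y.submatrix id (Subtype.val : {i // w i = b} → κ) := rfl
    have h2 : ((1 : Matrix κ κ ℂ).submatrix id (Subtype.val : {i // w i = b} → κ)).conjTranspose *
        M * (1 : Matrix κ κ ℂ).submatrix id (Subtype.val : {i // w i = b} → κ) =
          M.submatrix Subtype.val Subtype.val := by
      have h3 : ((1 : Matrix κ κ ℂ).submatrix id
          (Subtype.val : {i // w i = b} → κ)).conjTranspose * M *
            (1 : Matrix κ κ ℂ).submatrix id (Subtype.val : {i // w i = b} → κ) =
          ((1 : Matrix κ κ ℂ).conjTranspose * M * 1).submatrix Subtype.val Subtype.val := rfl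
      rw [h3]
      simp
    rw [h1, hYb, Matrix.conjTranspose_mul, ← h2]
    simp only [Matrix.mul_assoc]
  have hzero : ∀ i j, w i ≠ w j → Y i j = 0 := fun i j h => by simp only [hY, dif_neg h]
  have hone : Y.conjTranspose * Y = 1 := by
    ext j l
    by_cases hjl : w j = w l
    · have h := congrFun (congrFun (hblock 1 (w l)) ⟨j, hjl⟩) ⟨l, rfl⟩
      rw [Matrix.mul_one, Matrix.submatrix_one _ Subtype.val_injective, Matrix.mul_one,
        conjTranspose_mul_eigenvectorUnitary (H (w l))] at h
      simpa [Matrix.one_apply] using h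
    · rw [Matrix.one_apply_ne fun h => hjl (congrArg w h), Matrix.mul_apply]
      refine Finset.sum_eq_zero fun i _ => ?_
      by_cases hi : w i = w l
      · rw [Matrix.conjTranspose_apply, hzero i j fun h => hjl (h.symm.trans hi), star_zero,
          zero_mul]
      · rw [hzero i l hi, mul_zero]
  refine ⟨Y, mul_eq_one_comm.mp hone, hzero, fun j l hjl hne => ?_⟩
  have h := congrFun (congrFun (hblock A (w l)) ⟨j, hjl⟩) ⟨l, rfl⟩
  have hd : (Q (w l)).conjTranspose * A.submatrix Subtype.val Subtype.val * Q (w l) =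
      Matrix.diagonal fun i => ((H (w l)).eigenvalues i : ℂ) :=
    conjTranspose_mul_mul_eigenvectorUnitary (H (w l))
  rw [hd, Matrix.diagonal_apply_ne _ fun h => hne (congrArg Subtype.val h)] at h
  exact h

/-- An eigenbasis of `W` in which the pinching of `ρ` by the spectral projections of `W` is
diagonal. -/
lemma exists_pinching_basis {ρ W : Matrix κ κ ℂ} (hρ : ρ.IsHermitian) (hW : W.IsHermitian) :
    ∃ U : Matrix κ κ ℂ, U * U.conjTranspose = 1 ∧
      W = U * Matrix.diagonal (fun j => (hW.eigenvalues j : ℂ)) * U.conjTranspose ∧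
      matLog W = U * Matrix.diagonal (fun j => (Real.log (hW.eigenvalues j) : ℂ)) *
        U.conjTranspose ∧
      ∀ j l, hW.eigenvalues j = hW.eigenvalues l → j ≠ l →
        (U.conjTranspose * ρ * U) j l = 0 := by
  set V := (hW.eigenvectorUnitary : Matrix κ κ ℂ) with hV
  set w := hW.eigenvalues with hw
  obtain ⟨Y, hY, hY0, hYd⟩ := exists_block_diagonalizing
    (Matrix.isHermitian_conjTranspose_mul_mul V hρ) w
  have hc : ∀ g : ℝ → ℝ, V * Matrix.diagonal (fun j => (g (w j) : ℂ)) * V.conjTranspose =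
      V * Y * Matrix.diagonal (fun j => (g (w j) : ℂ)) * (V * Y).conjTranspose := by
    intro g
    have h : Y * Matrix.diagonal (fun j => (g (w j) : ℂ)) =
        Matrix.diagonal (fun j => (g (w j) : ℂ)) * Y := by
      ext i j
      rw [Matrix.mul_diagonal, Matrix.diagonal_mul]
      by_cases hij : w i = w j
      · rw [hij, mul_comm]
      · rw [hY0 i j hij, zero_mul, mul_zero]
    rw [Matrix.conjTranspose_mul, Matrix.mul_assoc V Y, h]
    simp only [← Matrix.mul_assoc]
    rw [Matrix.mul_assoc _ Y, hY, Matrix.mul_one]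
  refine ⟨V * Y, ?_, ?_, ?_, ?_⟩
  · rw [Matrix.conjTranspose_mul, Matrix.mul_assoc, ← Matrix.mul_assoc Y, hY, Matrix.one_mul]
    exact eigenvectorUnitary_mul_conjTranspose hW
  · rw [← hc fun x => x]
    exact eq_conj_diagonal hW
  · rw [← hc Real.log]
    exact matLog_eq hW
  · intro j l h1 h2
    rw [← hYd j l h1 h2, Matrix.conjTranspose_mul]
    simp only [Matrix.mul_assoc]

end Pinching

section PinchedTest

variable {κ : Type*} [Fintype κ] [DecidableEq κ]

lemma star_dotProduct_conj_diagonal_mulVec (X : Matrix κ κ ℂ) (p : κ → ℝ) (z : κ → ℂ) :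
    star z ⬝ᵥ (X.conjTranspose * Matrix.diagonal (fun i => (p i : ℂ)) * X).mulVec z =
      ((∑ i, p i * ‖X.mulVec z i‖ ^ 2 : ℝ) : ℂ) := by
  rw [← Matrix.mulVec_mulVec, ← Matrix.mulVec_mulVec, Matrix.dotProduct_mulVec,
    ← Matrix.star_mulVec, dotProduct, Complex.ofReal_sum]
  refine Finset.sum_congr rfl fun i _ => ?_
  rw [Matrix.mulVec_diagonal, Pi.star_apply, Complex.star_def, mul_left_comm,
    mul_comm _ (X.mulVec z i),
    Complex.mul_conj, Complex.normSq_eq_norm_sq]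
  push_cast
  ring

/-- The pinching inequality, in coordinates: on a block on which `Xᴴ diag(p) X` is diagonal. -/
lemma sum_mul_norm_sq_div_diag_le_one {X : Matrix κ κ ℂ} {p : κ → ℝ} (hp : ∀ i, 0 ≤ p i)
    {g : κ → ℝ} (hg : ∀ j, g j = ∑ i, p i * ‖X i j‖ ^ 2) {s : Finset κ}
    (hs : ∀ j ∈ s, ∀ l ∈ s, j ≠ l →
      (X.conjTranspose * Matrix.diagonal (fun i => (p i : ℂ)) * X) j l = 0) (i : κ) :
    ∑ j ∈ s, p i * ‖X i j‖ ^ 2 / g j ≤ 1 := by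
  set G := X.conjTranspose * Matrix.diagonal (fun i => (p i : ℂ)) * X with hG
  have hGd : ∀ j, G j j = g j := by
    intro j
    have h := star_dotProduct_conj_diagonal_mulVec X p (Pi.single j 1)
    rw [← hG] at h
    simp only [Matrix.mulVec_single_one, Matrix.col_apply] at h
    rw [← hg j] at h
    rw [← h, dotProduct, Finset.sum_eq_single j (fun k _ hk => by simp [Pi.single_eq_of_ne hk])
        (fun h => absurd (Finset.mem_univ _) h)]
    simp
  set t := ∑ j ∈ s, ‖X i j‖ ^ 2 / g j with ht
  have hsum : ∑ j ∈ s, p i * ‖X i j‖ ^ 2 / g j = p i * t := by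
    rw [ht, Finset.mul_sum]
    exact Finset.sum_congr rfl fun j _ => mul_div_assoc _ _ _
  set z : κ → ℂ := fun j => if j ∈ s then star (X i j) / (g j : ℂ) else 0 with hz
  have hXz : X.mulVec z i = (t : ℂ) := by
    rw [Matrix.mulVec, dotProduct, ht, Complex.ofReal_sum]
    simp only [hz, mul_ite, mul_zero]
    rw [Finset.sum_ite_mem, Finset.univ_inter]
    refine Finset.sum_congr rfl fun j _ => ?_
    rw [← mul_div_assoc, Complex.star_def, Complex.mul_conj, Complex.normSq_eq_norm_sq]
    push_cast
    rfl
  have hzGz : star z ⬝ᵥ G.mulVec z = (t : ℂ) := by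
    rw [dotProduct, ht, Complex.ofReal_sum, ← Finset.univ_inter s, ← Finset.sum_ite_mem]
    refine Finset.sum_congr rfl fun j _ => ?_
    split_ifs with hj
    · have h1 : G.mulVec z j = G j j * z j := by
        rw [Matrix.mulVec, dotProduct]
        refine Finset.sum_eq_single j (fun l _ hl => ?_) fun h => absurd (Finset.mem_univ _) h
        by_cases hls : l ∈ s
        · rw [hs j hj l hls hl.symm, zero_mul]
        · simp only [hz, if_neg hls, mul_zero]
      rw [h1, hGd, Pi.star_apply]
      simp only [hz, if_pos hj]
      by_cases h0 : g j = 0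
      · simp [h0]
      · have h0' : (g j : ℂ) ≠ 0 := by exact_mod_cast h0
        have h2 : X i j * star (X i j) = ((‖X i j‖ ^ 2 : ℝ) : ℂ) := by
          rw [Complex.star_def, Complex.mul_conj, Complex.normSq_eq_norm_sq]
        rw [star_div₀, star_star, Complex.star_def, Complex.conj_ofReal, Complex.ofReal_div,
          ← h2, Complex.star_def]
        field_simp
    · simp [hz, if_neg hj]
  have hle : p i * t ^ 2 ≤ t := by
    have h := star_dotProduct_conj_diagonal_mulVec X p z
    rw [← hG, hzGz] at h
    rw [Complex.ofReal_injective h]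
    refine le_trans (le_of_eq ?_) (Finset.single_le_sum
      (f := fun i => p i * ‖X.mulVec z i‖ ^ 2)
      (fun k _ => mul_nonneg (hp k) (sq_nonneg _)) (Finset.mem_univ i))
    simp only [hXz, Complex.norm_real, Real.norm_eq_abs, sq_abs]
    rw [← Complex.ofReal_injective h]
  rw [hsum]
  have ht0 : 0 ≤ t := by
    refine Finset.sum_nonneg fun j _ => div_nonneg (sq_nonneg _) ?_
    rw [hg]
    exact Finset.sum_nonneg fun k _ => mul_nonneg (hp k) (sq_nonneg _)
  rcases ht0.eq_or_lt with h0 | h0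
  · rw [← h0]; simp
  · by_contra! hcon
    nlinarith

/-- Pinching loses at most the logarithm of the number of distinct eigenvalues: there is a
commutative test statistic almost achieving the relative entropy. -/
lemma exists_diag_test {ρ W : Matrix κ κ ℂ} (hρ : IsState ρ) (hW : IsState W) {c : ℝ}
    (h : ((c + Real.log (Finset.univ.image hW.1.1.eigenvalues).card : ℝ) : EReal) <
      relEnt ρ W) :
    ∃ U : Matrix κ κ ℂ, U * U.conjTranspose = 1 ∧ ∃ f : κ → ℝ,
      ∑ a, ((U.conjTranspose * W * U) a a).re * Real.exp (f a) ≤ 2 ∧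
      c < ∑ a, ((U.conjTranspose * ρ * U) a a).re * f a := by
  have hρH := hρ.1.1
  have hWH := hW.1.1
  obtain ⟨U, hU, hWU, hlogW, hoff⟩ := exists_pinching_basis hρH hWH
  have hU' : U.conjTranspose * U = 1 := mul_eq_one_comm.mp hU
  set Z := (hρH.eigenvectorUnitary : Matrix κ κ ℂ) with hZ
  set p := hρH.eigenvalues with hp
  set w := hWH.eigenvalues with hw
  have hp0 : ∀ i, 0 ≤ p i := hρ.1.eigenvalues_nonneg
  have hw0 : ∀ i, 0 ≤ w i := hW.1.eigenvalues_nonneg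
  set X := Z.conjTranspose * U with hX
  set P : κ → κ → ℝ := fun i j => p i * ‖X i j‖ ^ 2 with hP
  have hP0 : ∀ i j, 0 ≤ P i j := fun i j => mul_nonneg (hp0 i) (sq_nonneg _)
  have hPsum : ∑ i, ∑ j, P i j = 1 := by
    have := sum_eigenvalues_mul_norm_sq hρH hU
    rwa [hρ.2, Complex.one_re] at this
  have hpsum : ∑ i, p i = 1 := by
    have := hρH.trace_eq_sum_eigenvalues
    rw [hρ.2] at this
    have h1 := congrArg Complex.re this
    simpa using h1.symm
  have hwsum : ∑ i, w i = 1 := by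
    have := hWH.trace_eq_sum_eigenvalues
    rw [hW.2] at this
    have h1 := congrArg Complex.re this
    simpa using h1.symm
  set g : κ → ℝ := fun j => ∑ i, P i j with hg
  have hg0 : ∀ j, 0 ≤ g j := fun j => Finset.sum_nonneg fun i _ => hP0 i j
  have hgsum : ∑ j, g j = 1 := by rw [← hPsum, Finset.sum_comm]
  have hUρU : U.conjTranspose * ρ * U =
      X.conjTranspose * Matrix.diagonal (fun i => (p i : ℂ)) * X := by
    conv_lhs => rw [eq_conj_diagonal hρH]
    rw [hX, Matrix.conjTranspose_mul, Matrix.conjTranspose_conjTranspose]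
    simp only [Matrix.mul_assoc]
    rfl
  have hρg : ∀ j, ((U.conjTranspose * ρ * U) j j).re = g j := by
    intro j
    have h1 := star_dotProduct_conj_diagonal_mulVec X p (Pi.single j 1)
    simp only [Matrix.mulVec_single_one, Matrix.col_apply] at h1
    rw [hUρU, ← Complex.ofReal_re (g j), ← show _ = ((g j : ℝ) : ℂ) from h1, dotProduct,
      Finset.sum_eq_single j (fun k _ hk => by simp [Pi.single_eq_of_ne hk])
        (fun h => absurd (Finset.mem_univ _) h)]
    simp
  have hUWU : U.conjTranspose * W * U = Matrix.diagonal (fun j => (w j : ℂ)) := by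
    rw [hWU]
    simp only [← Matrix.mul_assoc, hU', Matrix.one_mul]
    rw [Matrix.mul_assoc, hU', Matrix.mul_one]
  have hWw : ∀ j, ((U.conjTranspose * W * U) j j).re = w j := fun j => by
    rw [hUWU, Matrix.diagonal_apply_eq, Complex.ofReal_re]
  suffices hs : ∃ f : κ → ℝ, ∑ a, w a * Real.exp (f a) ≤ 2 ∧ c < ∑ a, g a * f a by
    obtain ⟨f, h1, h2⟩ := hs
    exact ⟨U, hU, f, (Finset.sum_congr rfl fun a _ => by rw [hWw]).trans_le h1,
      h2.trans_eq (Finset.sum_congr rfl fun a _ => by rw [hρg])⟩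
  by_cases hsupp : suppLE ρ W
  · have hgw : ∀ j, w j = 0 → g j = 0 := by
      intro j hj
      obtain ⟨M, hM⟩ := suppLE_iff_exists_mul.mp hsupp
      have h1 : U.conjTranspose * ρ * U =
          Matrix.diagonal (fun j => (w j : ℂ)) * (U.conjTranspose * M * U) := by
        rw [← hUWU, hM]
        calc _ = U.conjTranspose * W * 1 * M * U := by simp only [Matrix.mul_assoc, Matrix.one_mul]
          _ = _ := by rw [← hU]; simp only [Matrix.mul_assoc]
      rw [← hρg, h1, Matrix.diagonal_mul, hj]
      simp
    refine ⟨fun j => if g j = 0 then 0 else Real.log (g j) - Real.log (w j), ?_, ?_⟩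
    · calc _ ≤ ∑ j, (w j + g j) := by
            refine Finset.sum_le_sum fun j _ => ?_
            beta_reduce
            split_ifs with h0
            · simp [h0]
            · have hgj := (hg0 j).lt_of_ne' h0
              have hwj := (hw0 j).lt_of_ne' fun h => h0 (hgw j h)
              rw [Real.exp_sub, Real.exp_log hgj, Real.exp_log hwj, mul_div_cancel₀ _ hwj.ne']
              linarith
        _ = 2 := by rw [Finset.sum_add_distrib, hwsum, hgsum]; norm_num
    · rw [relEnt, if_pos hsupp, EReal.coe_lt_coe_iff, hlogW, trace_mul_matLog_sub hρH hU] at h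
      set N := (Finset.univ.image w).card with hN
      have hNpos : (0 : ℝ) < N := by
        have : N ≠ 0 := by
          intro h0
          rw [hN, Finset.card_eq_zero, Finset.image_eq_empty] at h0
          rw [h0, Finset.sum_empty] at hwsum
          exact zero_ne_one hwsum
        exact_mod_cast Nat.pos_of_ne_zero this
      have hrow : ∀ i, ∑ j, P i j / g j ≤ N := by
        intro i
        rw [← Finset.sum_fiberwise_of_maps_to
          (fun j (_ : j ∈ Finset.univ) => Finset.mem_image_of_mem w (Finset.mem_univ j))]
        refine (Finset.sum_le_card_nsmul _ _ 1 fun b _ => ?_).trans (by simp [hN])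
        refine sum_mul_norm_sq_div_diag_le_one hp0 (fun _ => rfl) (fun j hj l hl hne => ?_) i
        rw [← hUρU]
        exact hoff j l ((Finset.mem_filter.mp hj).2.trans (Finset.mem_filter.mp hl).2.symm) hne
      have hterm : ∀ i j, P i j * (Real.log (p i) - Real.log (g j)) ≤
          P i j * (Real.log N - 1) + p i * (P i j / g j) / N := by
        intro i j
        rcases (hP0 i j).eq_or_lt with h0 | h0
        · rw [← h0]; simp
        have hpi : 0 < p i := (hp0 i).lt_of_ne' fun h => by simp [hP, h] at h0
        have hgj : 0 < g j := h0.trans_le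
          (Finset.single_le_sum (f := fun i => P i j) (fun k _ => hP0 k j) (Finset.mem_univ i))
        have h1 := Real.log_le_sub_one_of_pos (div_pos hpi (mul_pos hgj hNpos))
        rw [Real.log_div hpi.ne' (mul_pos hgj hNpos).ne', Real.log_mul hgj.ne' hNpos.ne'] at h1
        have h2 : p i * (P i j / g j) / N = P i j * (p i / (g j * N)) := by field_simp
        rw [h2, ← mul_add]
        exact mul_le_mul_of_nonneg_left (by linarith) h0.le
      have hent : ∑ i, ∑ j, P i j * (Real.log (p i) - Real.log (g j)) ≤ Real.log N := by
        calc _ ≤ ∑ i, ∑ j, (P i j * (Real.log N - 1) + p i * (P i j / g j) / N) :=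
              Finset.sum_le_sum fun i _ => Finset.sum_le_sum fun j _ => hterm i j
          _ = (∑ i, ∑ j, P i j) * (Real.log N - 1) + (∑ i, p i * ∑ j, P i j / g j) / N := by
              rw [Finset.sum_mul, Finset.sum_div, ← Finset.sum_add_distrib]
              refine Finset.sum_congr rfl fun i _ => ?_
              rw [Finset.sum_mul, Finset.mul_sum, Finset.sum_div, ← Finset.sum_add_distrib]
          _ ≤ 1 * (Real.log N - 1) + (∑ i, p i * N) / N := by
              rw [hPsum]
              exact add_le_add le_rfl (div_le_div_of_nonneg_right (Finset.sum_le_sum fun i _ =>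
                mul_le_mul_of_nonneg_left (hrow i) (hp0 i)) hNpos.le)
          _ = Real.log N := by
              rw [← Finset.sum_mul, hpsum, one_mul, one_mul, div_self hNpos.ne']; ring
      have hsplit : ∑ i, ∑ j, P i j * (Real.log (p i) - Real.log (w j)) =
          ∑ i, ∑ j, P i j * (Real.log (p i) - Real.log (g j)) +
            ∑ j, g j * (Real.log (g j) - Real.log (w j)) := by
        rw [Finset.sum_comm,
          Finset.sum_comm (f := fun i j => P i j * (Real.log (p i) - Real.log (g j))),
          ← Finset.sum_add_distrib]
        refine Finset.sum_congr rfl fun j _ => ?_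
        rw [hg, Finset.sum_mul, ← Finset.sum_add_distrib]
        exact Finset.sum_congr rfl fun i _ => by ring
      have hf : ∑ j, g j * (if g j = 0 then 0 else Real.log (g j) - Real.log (w j)) =
          ∑ j, g j * (Real.log (g j) - Real.log (w j)) := by
        refine Finset.sum_congr rfl fun j _ => ?_
        split_ifs with h0
        · rw [h0, zero_mul, zero_mul]
        · rfl
      have h' : c + Real.log N < ∑ i, ∑ j, P i j * (Real.log (p i) - Real.log (w j)) := h
      rw [hf]
      linarith
  · obtain ⟨j, hwj, hgj⟩ : ∃ j, w j = 0 ∧ g j ≠ 0 := by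
      by_contra! hcon
      refine hsupp (suppLE_iff_exists_mul.mpr
        ⟨U * Matrix.diagonal (fun j => ((w j)⁻¹ : ℂ)) * U.conjTranspose * ρ, ?_⟩)
      have h1 : ρ * U * Matrix.diagonal (fun j => ((w j) * (w j)⁻¹ : ℂ)) = ρ * U := by
        ext i j
        rw [Matrix.mul_diagonal]
        by_cases hj : w j = 0
        · have h2 : ∀ i, (p i : ℂ) * X i j = 0 := by
            intro i
            have h3 := (Finset.sum_eq_zero_iff_of_nonneg fun i _ => hP0 i j).mp (hcon j hj) i
              (Finset.mem_univ _)
            rcases mul_eq_zero.mp h3 with h4 | h4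
            · rw [h4]; simp
            · rw [norm_eq_zero.mp (pow_eq_zero_iff two_ne_zero |>.mp h4), mul_zero]
          have h4 : ρ * U = Z * (Matrix.diagonal (fun i => (p i : ℂ)) * X) := by
            conv_lhs => rw [eq_conj_diagonal hρH]
            simp only [hX, Matrix.mul_assoc]
            rfl
          have h5 : (ρ * U) i j = 0 := by
            rw [h4, Matrix.mul_apply]
            refine Finset.sum_eq_zero fun k _ => ?_
            rw [Matrix.diagonal_mul, h2, mul_zero]
          rw [h5, zero_mul]
        · rw [← Complex.ofReal_mul, mul_inv_cancel₀ hj, Complex.ofReal_one, mul_one]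
      have h2 : ρ = ρ * (U * Matrix.diagonal (fun j => ((w j) * (w j)⁻¹ : ℂ)) *
          U.conjTranspose) := by
        rw [← Matrix.mul_assoc, ← Matrix.mul_assoc, h1, Matrix.mul_assoc, hU, Matrix.mul_one]
      have h3 := congrArg Matrix.conjTranspose h2
      rw [Matrix.conjTranspose_mul, hρH.eq] at h3
      have h4 : (U * Matrix.diagonal (fun j => ((w j) * (w j)⁻¹ : ℂ)) *
          U.conjTranspose).conjTranspose =
          W * (U * Matrix.diagonal (fun j => ((w j)⁻¹ : ℂ)) * U.conjTranspose) := by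
        have h5 : (Matrix.diagonal (fun j => ((w j) * (w j)⁻¹ : ℂ))).conjTranspose =
            Matrix.diagonal (fun j => (w j : ℂ)) * Matrix.diagonal (fun j => ((w j)⁻¹ : ℂ)) := by
          rw [Matrix.diagonal_conjTranspose, Matrix.diagonal_mul_diagonal]
          congr 1
          funext j
          simp
        rw [hWU, Matrix.conjTranspose_mul, Matrix.conjTranspose_mul,
          Matrix.conjTranspose_conjTranspose, h5]
        calc _ = U * Matrix.diagonal (fun j => (w j : ℂ)) * 1 *
              Matrix.diagonal (fun j => ((w j)⁻¹ : ℂ)) * U.conjTranspose := by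
                simp only [Matrix.mul_assoc, Matrix.one_mul]
          _ = _ := by rw [← hU']; simp only [Matrix.mul_assoc]
      rwa [h4, Matrix.mul_assoc] at h3
    set K := (|c| + 1) / g j with hK
    have hgj' := (hg0 j).lt_of_ne' hgj
    refine ⟨Pi.single j K, ?_, ?_⟩
    · calc _ = ∑ a, w a := by
            refine Finset.sum_congr rfl fun a _ => ?_
            by_cases ha : a = j
            · subst ha; rw [hwj, zero_mul]
            · rw [Pi.single_eq_of_ne ha, Real.exp_zero, mul_one]
        _ ≤ 2 := by rw [hwsum]; norm_num
    · rw [Finset.sum_eq_single j (fun k _ hk => by simp [Pi.single_eq_of_ne hk])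
        (fun h => absurd (Finset.mem_univ _) h), Pi.single_eq_same, hK, mul_div_cancel₀ _ hgj]
      linarith [le_abs_self c]

end PinchedTest

section BlockTest

variable {κ : Type*} [Fintype κ]

lemma sum_indicator_mul_prod_le {m : ℕ} {q g : κ → ℝ} (hq : ∀ a, 0 ≤ q a)
    {S : Set (Fin m → κ)} (hS : ∀ x ∈ S, 0 ≤ ∑ b, g (x b)) :
    ∑ x, S.indicator (fun _ => (1 : ℝ)) x * ∏ b, q (x b) ≤ (∑ a, q a * Real.exp (g a)) ^ m := by
  rw [Fintype.sum_pow]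
  refine Finset.sum_le_sum fun x _ => ?_
  rw [Finset.prod_mul_distrib, ← Real.exp_sum, mul_comm]
  refine mul_le_mul_of_nonneg_left ?_ (Finset.prod_nonneg fun b _ => hq _)
  by_cases hx : x ∈ S
  · rw [Set.indicator_of_mem hx]
    exact Real.one_le_exp (hS x hx)
  · rw [Set.indicator_of_notMem hx]
    exact (Real.exp_pos _).le

variable [DecidableEq κ]

lemma trace_tensorPow_mul_conj_diagonal (U : Matrix κ κ ℂ) {τ : Matrix κ κ ℂ}
    (hτ : τ.IsHermitian) {m : ℕ} (d : (Fin m → κ) → ℝ) :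
    (tensorPow τ m * (tensorPow U m * Matrix.diagonal (fun x => (d x : ℂ)) *
      (tensorPow U m).conjTranspose)).trace.re =
      ∑ x, d x * ∏ b, ((U.conjTranspose * τ * U) (x b) (x b)).re := by
  have hH : (U.conjTranspose * τ * U).IsHermitian := Matrix.isHermitian_conjTranspose_mul_mul U hτ
  have h1 : (tensorPow U m).conjTranspose * tensorPow τ m * tensorPow U m =
      tensorPow (U.conjTranspose * τ * U) m := by
    simp only [tensorPow_eq_tensorProdFam, tensorProdFam_conjTranspose, tensorProdFam_mul]
  have h2 : (tensorPow τ m * (tensorPow U m * Matrix.diagonal (fun x => (d x : ℂ)) *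
      (tensorPow U m).conjTranspose)).trace =
      (tensorPow (U.conjTranspose * τ * U) m * Matrix.diagonal (fun x => (d x : ℂ))).trace := by
    rw [← h1, ← Matrix.mul_assoc, Matrix.trace_mul_comm]
    simp only [Matrix.mul_assoc]
  rw [h2, Matrix.trace, Complex.re_sum]
  refine Finset.sum_congr rfl fun x _ => ?_
  have h3 : tensorPow (U.conjTranspose * τ * U) m x x =
      ((∏ b, ((U.conjTranspose * τ * U) (x b) (x b)).re : ℝ) : ℂ) := by
    rw [Complex.ofReal_prod]
    exact Finset.prod_congr rfl fun b _ => (hH.coe_re_apply_self (x b)).symm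
  rw [Matrix.diag_apply, Matrix.mul_diagonal, h3, ← Complex.ofReal_mul, Complex.ofReal_re, mul_comm]

/-- The Chernoff bound for the threshold test of a commuting additive statistic. -/
lemma exists_threshold_test {U : Matrix κ κ ℂ} (hU : U * U.conjTranspose = 1) (f : κ → ℝ)
    (m : ℕ) : ∃ E : MatN κ m, E.PosSemidef ∧ (1 - E).PosSemidef ∧
      (∀ τ : Matrix κ κ ℂ, τ.PosSemidef → (tensorPow τ m * E).trace.re ≤
        (∑ a, ((U.conjTranspose * τ * U) a a).re * Real.exp (f a)) ^ m) ∧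
      ∀ τ : Matrix κ κ ℂ, τ.PosSemidef → ∀ s : ℝ, 0 ≤ s →
        (tensorPow τ m * (1 - E)).trace.re ≤
          (∑ a, ((U.conjTranspose * τ * U) a a).re * Real.exp (-(s * f a))) ^ m := by
  set S : Set (Fin m → κ) := {x | 0 ≤ ∑ b, f (x b)} with hS
  set F : Set (Fin m → κ) → MatN κ m := fun S => tensorPow U m *
    Matrix.diagonal (fun x => ((S.indicator (fun _ => (1 : ℝ)) x : ℝ) : ℂ)) *
      (tensorPow U m).conjTranspose with hF
  have hpsd : ∀ S, (F S).PosSemidef := by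
    intro S
    refine Matrix.PosSemidef.mul_mul_conjTranspose_same (Matrix.PosSemidef.diagonal fun x => ?_) _
    have : (0 : ℝ) ≤ S.indicator (fun _ => (1 : ℝ)) x :=
      Set.indicator_nonneg (fun _ _ => zero_le_one) x
    simpa using this
  have hcompl : 1 - F S = F Sᶜ := by
    have hT : tensorPow U m * (tensorPow U m).conjTranspose = 1 := by
      rw [tensorPow_eq_tensorProdFam, tensorProdFam_conjTranspose, tensorProdFam_mul]
      simp only [hU]
      exact tensorProdFam_one
    rw [sub_eq_iff_eq_add, hF]
    beta_reduce
    rw [← Matrix.add_mul, ← Matrix.mul_add, Matrix.diagonal_add, ← hT]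
    congr 1
    conv_lhs => rw [← Matrix.mul_one (tensorPow U m), ← Matrix.diagonal_one]
    congr 2
    funext x
    by_cases hx : x ∈ S <;> simp [hx]
  have hq : ∀ τ : Matrix κ κ ℂ, τ.PosSemidef → ∀ a, 0 ≤ ((U.conjTranspose * τ * U) a a).re :=
    fun τ hτ a => (Complex.le_def.mp
      ((hτ.conjTranspose_mul_mul_same U).diag_nonneg (i := a))).1
  refine ⟨F S, hpsd S, hcompl ▸ hpsd Sᶜ, fun τ hτ => ?_, fun τ hτ s hs => ?_⟩
  · rw [hF, trace_tensorPow_mul_conj_diagonal U hτ.1]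
    exact sum_indicator_mul_prod_le (hq τ hτ) fun x hx => hx
  · rw [hcompl, hF, trace_tensorPow_mul_conj_diagonal U hτ.1]
    refine sum_indicator_mul_prod_le (hq τ hτ) fun x hx => ?_
    have hx' : ∑ b, f (x b) < 0 := not_le.mp hx
    rw [Finset.sum_neg_distrib, ← Finset.mul_sum]
    nlinarith

variable {ι : Type*} [Fintype ι] [DecidableEq ι]

/-- A test on blocks of `k` copies induces a test on `n` copies that ignores the remaining
`n % k` copies. -/
lemma exists_test_of_blocks {k n : ℕ} {E : MatN (Fin k → ι) (n / k)} (hE : E.PosSemidef)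
    (hE' : (1 - E).PosSemidef) : ∃ F : MatN ι n, F.PosSemidef ∧ (1 - F).PosSemidef ∧
      ∀ σ : MatC ι, IsState σ →
        (tensorPow σ n * F).trace = (tensorPow (tensorPow σ k) (n / k) * E).trace ∧
        (tensorPow σ n * (1 - F)).trace = (tensorPow (tensorPow σ k) (n / k) * (1 - E)).trace := by
  set ε : (Fin (n / k) × Fin k) ⊕ Fin (n % k) ≃ Fin n :=
    (Equiv.sumCongr finProdFinEquiv (Equiv.refl _)).trans
      (finSumFinEquiv.trans (finCongr (Nat.div_add_mod' n k))) with hε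
  set e : (Fin n → ι) ≃ (Fin (n / k) → Fin k → ι) × (Fin (n % k) → ι) :=
    (Equiv.arrowCongr ε.symm (Equiv.refl ι)).trans
      ((Equiv.sumArrowEquivProdArrow _ _ _).trans
        (Equiv.prodCongr (Equiv.curry _ _ _) (Equiv.refl _))) with he
  have hpow : ∀ σ : MatC ι, tensorPow σ n = (Matrix.kronecker (tensorPow (tensorPow σ k) (n / k))
      (tensorPow σ (n % k))).submatrix e e := by
    intro σ
    ext i j
    have h1 : tensorPow σ n i j = ∏ x, σ (i (ε x)) (j (ε x)) :=
      (Equiv.prod_comp ε fun t => σ (i t) (j t)).symm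
    rw [h1, Fintype.prod_sum_type, Fintype.prod_prod_type]
    rfl
  have htr : ∀ (σ : MatC ι), IsState σ → ∀ M : MatN (Fin k → ι) (n / k),
      (tensorPow σ n * (Matrix.kronecker M (1 : MatN ι (n % k))).submatrix e e).trace =
        (tensorPow (tensorPow σ k) (n / k) * M).trace := by
    intro σ hσ M
    rw [hpow, Matrix.submatrix_mul_equiv]
    have h2 : ∀ Q : Matrix ((Fin (n / k) → Fin k → ι) × (Fin (n % k) → ι))
        ((Fin (n / k) → Fin k → ι) × (Fin (n % k) → ι)) ℂ,
        (Q.submatrix e e).trace = Q.trace := fun Q => Equiv.sum_comp e fun x => Q x x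
    rw [h2]
    have h3 := Matrix.mul_kronecker_mul (tensorPow (tensorPow σ k) (n / k)) M
      (tensorPow σ (n % k)) (1 : MatN ι (n % k))
    have h4 := congrArg Matrix.trace h3
    rw [Matrix.trace_kronecker, Matrix.mul_one, (isState_tensorPow hσ _).2, mul_one] at h4
    exact h4.symm
  have hone : 1 - (Matrix.kronecker E (1 : MatN ι (n % k))).submatrix e e =
      (Matrix.kronecker (1 - E) (1 : MatN ι (n % k))).submatrix e e := by
    have h := Matrix.add_kronecker (1 - E) E (1 : MatN ι (n % k))
    rw [sub_add_cancel, Matrix.one_kronecker_one] at h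
    rw [sub_eq_iff_eq_add, ← Matrix.submatrix_one_equiv e, h]
    rfl
  refine ⟨(Matrix.kronecker E (1 : MatN ι (n % k))).submatrix e e,
    (hE.kronecker Matrix.PosSemidef.one).submatrix e, ?_, fun σ hσ => ⟨htr σ hσ E, ?_⟩⟩
  · rw [hone]
    exact (hE'.kronecker Matrix.PosSemidef.one).submatrix e
  · rw [hone]
    exact htr σ hσ _

end BlockTest

section LocalTests

lemma exists_sum_mul_exp_lt_one {κ : Type*} [Fintype κ] {q f : κ → ℝ} (hq : ∀ a, 0 ≤ q a)
    (hq1 : ∑ a, q a = 1) (hf : 0 < ∑ a, q a * f a) :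
    ∃ s : ℝ, 0 < s ∧ ∑ a, q a * Real.exp (-(s * f a)) < 1 := by
  set L := ∑ a, q a * f a with hL
  set K := ∑ a, |f a| with hK
  have hfK : ∀ a, |f a| ≤ K := fun a =>
    Finset.single_le_sum (f := fun a => |f a|) (fun k _ => abs_nonneg _) (Finset.mem_univ a)
  have hLK : L ≤ K := by
    calc L ≤ ∑ a, q a * K := Finset.sum_le_sum fun a _ =>
          mul_le_mul_of_nonneg_left ((le_abs_self _).trans (hfK a)) (hq a)
      _ = K := by rw [← Finset.sum_mul, hq1, one_mul]
  have hK0 : 0 < K := hf.trans_le hLK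
  set s := L / (2 * K ^ 2) with hs
  have hs0 : 0 < s := by positivity
  have hsK : s * K ≤ 1 := by
    rw [hs, div_mul_eq_mul_div, div_le_one (by positivity)]
    nlinarith
  refine ⟨s, hs0, ?_⟩
  have hpt : ∀ a, q a * Real.exp (-(s * f a)) ≤ q a - s * (q a * f a) + q a * (s * K) ^ 2 := by
    intro a
    have h1 : |-(s * f a)| ≤ s * K := by
      rw [abs_neg, abs_mul, abs_of_pos hs0]
      exact mul_le_mul_of_nonneg_left (hfK a) hs0.le
    have h2 := (abs_le.mp (Real.abs_exp_sub_one_sub_id_le (h1.trans hsK))).2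
    have h3 : (-(s * f a)) ^ 2 ≤ (s * K) ^ 2 := by
      rw [← sq_abs]
      exact pow_le_pow_left₀ (abs_nonneg _) h1 2
    have h4 : Real.exp (-(s * f a)) ≤ 1 - s * f a + (s * K) ^ 2 := by linarith
    calc _ ≤ q a * (1 - s * f a + (s * K) ^ 2) := mul_le_mul_of_nonneg_left h4 (hq a)
      _ = _ := by ring
  calc _ ≤ ∑ a, (q a - s * (q a * f a) + q a * (s * K) ^ 2) :=
        Finset.sum_le_sum fun a _ => hpt a
    _ = 1 - s * L + (s * K) ^ 2 := by
        rw [Finset.sum_add_distrib, Finset.sum_sub_distrib, ← Finset.mul_sum, ← Finset.sum_mul,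
          hq1, one_mul]
    _ < 1 := by
        have : s * L = 2 * (s * K) ^ 2 := by rw [hs]; field_simp
        have h5 : 0 < (s * K) ^ 2 := by positivity
        linarith

variable {ι : Type*} [Fintype ι] [DecidableEq ι]

/-- `A` can be tested against `B` with type II error of exponential rate `R`, uniformly over the
i.i.d. states. -/
def HasTests (A B : Set (MatC ι)) (R : ℝ) : Prop :=
  ∀ ε : ℝ, 0 < ε → ∃ C : ℝ, 0 < C ∧ ∀ᶠ n : ℕ in atTop, ∃ E : MatN ι n,
    E.PosSemidef ∧ (1 - E).PosSemidef ∧ (∀ ρ ∈ A, (tensorPow ρ n * (1 - E)).trace.re ≤ ε) ∧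
      ∀ σ ∈ B, (tensorPow σ n * E).trace.re ≤ C * Real.exp (-(n * R))

lemma pow_div_le_exp {M : ℝ} (hM : 0 < M) {k : ℕ} (hk : 0 < k) (n : ℕ) :
    M ^ (n / k) ≤ Real.exp |Real.log M| * Real.exp (-(n * (-Real.log M / k))) := by
  have hk' : (0 : ℝ) < k := by exact_mod_cast hk
  rw [← Real.exp_add, ← Real.log_le_iff_le_exp (pow_pos hM _), Real.log_pow]
  have h1 : (k : ℝ) * (n / k : ℕ) + (n % k : ℕ) = n := by exact_mod_cast Nat.div_add_mod n k
  have h2 : ((n % k : ℕ) : ℝ) ≤ k := by exact_mod_cast (Nat.mod_lt n hk).le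
  have h3 : (0 : ℝ) ≤ (n % k : ℕ) := Nat.cast_nonneg _
  have h4 : -((n : ℝ) * (-Real.log M / k)) = (n / k : ℕ) * Real.log M +
      (n % k : ℕ) / k * Real.log M := by
    rw [← h1]; field_simp
  have h5 : |((n % k : ℕ) : ℝ) / k * Real.log M| ≤ |Real.log M| := by
    rw [abs_mul, abs_of_nonneg (div_nonneg h3 hk'.le)]
    exact mul_le_of_le_one_left (abs_nonneg _) ((div_le_one hk').mpr h2)
  rw [h4]
  linarith [neg_abs_le ((n % k : ℕ) / k * Real.log M)]

lemma exists_nhds_hasTests {B : Set (MatC ι)} (hB : ∀ σ ∈ B, IsState σ) {ρ : MatC ι}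
    (hρ : IsState ρ) {k : ℕ} (hk : 0 < k) {U : MatN ι k} (hU : U * U.conjTranspose = 1)
    {f : (Fin k → ι) → ℝ} {M : ℝ} (hM : 0 < M)
    (hf : 0 < ∑ a, ((U.conjTranspose * tensorPow ρ k * U) a a).re * f a)
    (hBf : ∀ σ ∈ B,
      ∑ a, ((U.conjTranspose * tensorPow σ k * U) a a).re * Real.exp (f a) ≤ M) :
    ∃ V ∈ 𝓝 ρ, ∀ A : Set (MatC ι), (∀ τ ∈ A, IsState τ) →
      HasTests (V ∩ A) B (-Real.log M / k) := by
  have hdiag : ∀ τ : MatC ι, IsState τ → ∀ a,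
      0 ≤ ((U.conjTranspose * tensorPow τ k * U) a a).re := fun τ hτ a =>
    (Complex.le_def.mp (((isState_tensorPow hτ k).1.conjTranspose_mul_mul_same U).diag_nonneg
      (i := a))).1
  obtain ⟨s, hs, hφ⟩ := exists_sum_mul_exp_lt_one (hdiag ρ hρ) (by
    rw [← Complex.re_sum]
    change ((U.conjTranspose * tensorPow ρ k * U).trace).re = 1
    rw [Matrix.mul_assoc, Matrix.trace_mul_comm, Matrix.mul_assoc, hU, Matrix.mul_one,
      (isState_tensorPow hρ k).2, Complex.one_re]) hf
  set φ : MatC ι → ℝ := fun τ =>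
    ∑ a, ((U.conjTranspose * tensorPow τ k * U) a a).re * Real.exp (-(s * f a)) with hφd
  have hcont : Continuous φ := by
    refine continuous_finsetSum _ fun a _ => Continuous.mul ?_ continuous_const
    exact Complex.continuous_re.comp
      (((continuous_const.matrix_mul (continuous_tensorPow k)).matrix_mul
        continuous_const).matrix_elem a a)
  obtain ⟨θ, hθ1, hθ2⟩ := exists_between hφ
  have hθ0 : 0 ≤ θ := (Finset.sum_nonneg fun a _ =>
    mul_nonneg (hdiag ρ hρ a) (Real.exp_pos _).le).trans hθ1.le
  refine ⟨{τ | φ τ < θ}, (isOpen_lt hcont continuous_const).mem_nhds hθ1, fun A hA ε hε =>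
    ⟨Real.exp |Real.log M|, Real.exp_pos _, ?_⟩⟩
  have hlim : Tendsto (fun n : ℕ => θ ^ (n / k)) atTop (𝓝 0) :=
    (tendsto_pow_atTop_nhds_zero_of_lt_one hθ0 hθ2).comp (Nat.tendsto_div_const_atTop hk.ne')
  filter_upwards [hlim.eventually_le_const hε] with n hn
  obtain ⟨E, hE, hE', hII, hI⟩ := exists_threshold_test hU f (n / k)
  obtain ⟨F, hF, hF', hFE⟩ := exists_test_of_blocks hE hE'
  refine ⟨F, hF, hF', ?_, fun σ hσ => ?_⟩
  · rintro τ ⟨hτ, hτA⟩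
    rw [(hFE τ (hA τ hτA)).2]
    refine (hI _ (isState_tensorPow (hA τ hτA) k).1 s hs.le).trans (le_trans ?_ hn)
    exact pow_le_pow_left₀ (Finset.sum_nonneg fun a _ =>
      mul_nonneg (hdiag τ (hA τ hτA) a) (Real.exp_pos _).le) (le_of_lt hτ) _
  · rw [(hFE σ (hB σ hσ)).1]
    refine (hII _ (isState_tensorPow (hB σ hσ) k).1).trans (le_trans ?_ (pow_div_le_exp hM hk n))
    exact pow_le_pow_left₀ (Finset.sum_nonneg fun a _ =>
      mul_nonneg (hdiag σ (hB σ hσ) a) (Real.exp_pos _).le) (hBf σ hσ) _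

end LocalTests

section UnionTests

lemma inv_sub_inv_eq {R : Type*} [Ring R] {a z t y : R} (h1 : a * z = 1) (h2 : z * a = 1)
    (h3 : t * y = 1) (h4 : y * t = 1) :
    z - y = y * ((t - a) + (t - a) * z * (t - a)) * y := by
  have h : (t - a) + (t - a) * z * (t - a) = t * z * t - t := by
    have e : (t - a) * z * (t - a) = t * z * t - t * (z * a) - (a * z) * t + (a * z) * a := by
      noncomm_ring
    rw [e, h1, h2]
    noncomm_ring
  rw [h]
  calc z - y = (y * t) * z * (t * y) - (y * t) * y := by rw [h3, h4]; noncomm_ring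
    _ = _ := by noncomm_ring

variable {κ : Type*} [Fintype κ]

lemma PosSemidef.exists_inv_add_smul_one [DecidableEq κ] {T : Matrix κ κ ℂ} (hT : T.PosSemidef)
    {η : ℝ} (hη : 0 < η) : ∃ Y : Matrix κ κ ℂ, Y.PosSemidef ∧
      (T + (η : ℂ) • 1) * Y = 1 ∧ Y * (T + (η : ℂ) • 1) = 1 := by
  have h : (T + (η : ℂ) • (1 : Matrix κ κ ℂ)).PosDef :=
    Matrix.PosDef.posSemidef_add hT (Matrix.PosDef.one.smul (by exact_mod_cast hη))
  have hu := h.isUnit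
  refine ⟨(T + (η : ℂ) • 1)⁻¹, h.inv.posSemidef, ?_, ?_⟩
  · exact Matrix.mul_nonsing_inv _ ((Matrix.isUnit_iff_isUnit_det _).mp hu)
  · exact Matrix.nonsing_inv_mul _ ((Matrix.isUnit_iff_isUnit_det _).mp hu)

lemma PosSemidef.mul_mul_self {X A : Matrix κ κ ℂ} (hX : X.PosSemidef) (hA : A.PosSemidef) :
    (X * A * X).PosSemidef := by
  have := hA.mul_mul_conjTranspose_same X
  rwa [hX.1.eq] at this

variable [DecidableEq κ]

/-- A resolvent bound used to combine two tests into one. -/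
lemma smul_inv_le_of_le {E T Y : Matrix κ κ ℂ} (hE : E.PosSemidef) (hE' : (1 - E).PosSemidef)
    (hD : (T - E).PosSemidef) (hY : Y.PosSemidef) {η : ℝ} (hη : 0 < η)
    (h1 : (T + (η : ℂ) • 1) * Y = 1) (h2 : Y * (T + (η : ℂ) • 1) = 1) :
    ((1 - E) + (η : ℂ) • 1 - (η : ℂ) • Y).PosSemidef := by
  obtain ⟨Z, hZ, hZ1, hZ2⟩ := PosSemidef.exists_inv_add_smul_one hE hη
  have hZY : (Z - Y).PosSemidef := by
    rw [inv_sub_inv_eq hZ1 hZ2 h1 h2, add_sub_add_right_eq_sub]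
    exact PosSemidef.mul_mul_self hY (hD.add (PosSemidef.mul_mul_self hD hZ))
  have hK : ((1 - E) + (η : ℂ) • 1 - (η : ℂ) • Z).PosSemidef := by
    have hpos : (E * (1 - E) * E + (η : ℂ) • (E - E * E) + ((η ^ 2 : ℝ) : ℂ) • E +
        ((η ^ 3 : ℝ) : ℂ) • (1 : Matrix κ κ ℂ)).PosSemidef :=
      (((PosSemidef.mul_mul_self hE hE').add
        (PosSemidef.real_smul (sub_mul_self_posSemidef hE hE') hη.le)).add
        (PosSemidef.real_smul hE (by positivity))).add
        (PosSemidef.real_smul Matrix.PosSemidef.one (by positivity))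
    have e : (1 - E) + (η : ℂ) • 1 - (η : ℂ) • Z =
        Z * (E * (1 - E) * E + (η : ℂ) • (E - E * E) + ((η ^ 2 : ℝ) : ℂ) • E +
          ((η ^ 3 : ℝ) : ℂ) • (1 : Matrix κ κ ℂ)) * Z := by
      have e1 : E * (1 - E) * E + (η : ℂ) • (E - E * E) + ((η ^ 2 : ℝ) : ℂ) • E +
          ((η ^ 3 : ℝ) : ℂ) • (1 : Matrix κ κ ℂ) =
          (E + (η : ℂ) • 1) * ((1 - E) + (η : ℂ) • 1) * (E + (η : ℂ) • 1) -
            (η : ℂ) • (E + (η : ℂ) • 1) := by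
        push_cast
        simp only [mul_add, add_mul, mul_sub, sub_mul, mul_one, one_mul, smul_add, smul_sub,
          Matrix.mul_smul, Matrix.smul_mul, smul_smul, pow_succ, pow_zero, one_mul]
        module
      rw [e1, mul_sub, sub_mul, Matrix.mul_smul, Matrix.smul_mul, hZ2, Matrix.one_mul]
      congr 1
      calc _ = (Z * (E + (η : ℂ) • 1)) * ((1 - E) + (η : ℂ) • 1) * ((E + (η : ℂ) • 1) * Z) := by
            rw [hZ1, hZ2, Matrix.one_mul, Matrix.mul_one]
        _ = _ := by simp only [Matrix.mul_assoc]
    rw [e]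
    exact PosSemidef.mul_mul_self hZ hpos
  have := hK.add (PosSemidef.real_smul hZY hη.le)
  rw [smul_sub] at this
  simpa using this

lemma exists_union_test {E₁ E₂ : Matrix κ κ ℂ} (h₁ : E₁.PosSemidef) (h₁' : (1 - E₁).PosSemidef)
    (h₂ : E₂.PosSemidef) (h₂' : (1 - E₂).PosSemidef) {η : ℝ} (hη : 0 < η) :
    ∃ E : Matrix κ κ ℂ, E.PosSemidef ∧ (1 - E).PosSemidef ∧
      (∀ ρ, IsState ρ → (ρ * (1 - E)).trace.re ≤ (ρ * (1 - E₁)).trace.re + η) ∧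
      (∀ ρ, IsState ρ → (ρ * (1 - E)).trace.re ≤ (ρ * (1 - E₂)).trace.re + η) ∧
      ∀ σ, IsState σ → (σ * E).trace.re ≤
        ((σ * E₁).trace.re + (σ * E₂).trace.re) / η := by
  have hT := h₁.add h₂
  obtain ⟨Y, hY, hY1, hY2⟩ := PosSemidef.exists_inv_add_smul_one hT hη
  set T := E₁ + E₂ with hTd
  have hTT : (T * T).PosSemidef := by
    have := PosSemidef.mul_mul_self hT Matrix.PosSemidef.one
    rwa [Matrix.mul_one] at this
  have hTY : T * Y = 1 - (η : ℂ) • Y := by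
    rw [add_mul, Matrix.smul_mul, Matrix.one_mul] at hY1
    exact eq_sub_of_add_eq hY1
  have hsand : ∀ X : Matrix κ κ ℂ, X * Y = Y * (T * X + (η : ℂ) • X) * Y := fun X => by
    calc X * Y = (Y * (T + (η : ℂ) • 1)) * X * Y := by rw [hY2, Matrix.one_mul]
      _ = _ := by
        congr 1
        rw [Matrix.mul_assoc, add_mul, Matrix.smul_mul, Matrix.one_mul]
  have htrη : ∀ ρ : Matrix κ κ ℂ, IsState ρ → ∀ F : Matrix κ κ ℂ,
      (ρ * (F + (η : ℂ) • 1)).trace.re = (ρ * F).trace.re + η := fun ρ hρ F => by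
    rw [mul_add, Matrix.mul_smul, Matrix.mul_one, Matrix.trace_add, Matrix.trace_smul, hρ.2]
    simp
  refine ⟨1 - (η : ℂ) • Y, ?_, ?_, fun ρ hρ => ?_, fun ρ hρ => ?_, fun σ hσ => ?_⟩
  · rw [← hTY, hsand]
    exact PosSemidef.mul_mul_self hY (hTT.add (PosSemidef.real_smul hT hη.le))
  · rw [sub_sub_cancel]
    exact PosSemidef.real_smul hY hη.le
  · rw [sub_sub_cancel, ← htrη ρ hρ]
    refine trace_mul_re_mono_right (smul_inv_le_of_le h₁ h₁' ?_ hY hη hY1 hY2) hρ.1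
    rwa [hTd, add_sub_cancel_left]
  · rw [sub_sub_cancel, ← htrη ρ hρ]
    refine trace_mul_re_mono_right (smul_inv_le_of_le h₂ h₂' ?_ hY hη hY1 hY2) hρ.1
    rwa [hTd, add_sub_cancel_right]
  · have hle : (T - (η : ℂ) • (1 - (η : ℂ) • Y)).PosSemidef := by
      have e : T - (η : ℂ) • (1 - (η : ℂ) • Y) = T * T * Y := by
        rw [Matrix.mul_assoc, hTY, mul_sub, Matrix.mul_smul, hTY, Matrix.mul_one]
      rw [e, hsand]
      refine PosSemidef.mul_mul_self hY (Matrix.PosSemidef.add ?_ (PosSemidef.real_smul hTT hη.le))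
      rw [← Matrix.mul_assoc]
      exact PosSemidef.mul_mul_self hT hT
    have := trace_mul_re_mono_right hle hσ.1
    rw [Matrix.mul_smul, Matrix.trace_smul, hTd, mul_add, Matrix.trace_add, Complex.add_re] at this
    rw [le_div_iff₀ hη, mul_comm]
    simpa using this

end UnionTests

section HasTests

variable {ι : Type*} [Fintype ι] [DecidableEq ι] {A A' B : Set (MatC ι)} {R R' : ℝ}

lemma HasTests.mono (h : HasTests A B R) (hA : A' ⊆ A) (hR : R' ≤ R) : HasTests A' B R' := by
  intro ε hε
  obtain ⟨C, hC, hev⟩ := h ε hε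
  refine ⟨C, hC, hev.mono ?_⟩
  rintro n ⟨E, hE, hE', hI, hII⟩
  refine ⟨E, hE, hE', fun ρ hρ => hI ρ (hA hρ), fun σ hσ => (hII σ hσ).trans ?_⟩
  gcongr

lemma hasTests_empty (B : Set (MatC ι)) (R : ℝ) : HasTests ∅ B R := by
  refine fun ε _ => ⟨1, one_pos, Eventually.of_forall fun n => ⟨0, Matrix.PosSemidef.zero, ?_, ?_,
    fun σ _ => ?_⟩⟩
  · rw [sub_zero]; exact Matrix.PosSemidef.one
  · simp
  · simp [(Real.exp_pos _).le]

lemma HasTests.union (hA : ∀ ρ ∈ A, IsState ρ) (hA' : ∀ ρ ∈ A', IsState ρ)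
    (hB : ∀ σ ∈ B, IsState σ) (h : HasTests A B R) (h' : HasTests A' B R) :
    HasTests (A ∪ A') B R := by
  intro ε hε
  obtain ⟨C, hC, hev⟩ := h (ε / 2) (half_pos hε)
  obtain ⟨C', hC', hev'⟩ := h' (ε / 2) (half_pos hε)
  refine ⟨(C + C') / (ε / 2), by positivity, ?_⟩
  filter_upwards [hev, hev']
  rintro n ⟨E, hE, hE', hI, hII⟩ ⟨F, hF, hF', hI', hII'⟩
  obtain ⟨G, hG, hG', hGE, hGF, hGB⟩ := exists_union_test hE hE' hF hF' (half_pos hε)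
  refine ⟨G, hG, hG', ?_, fun σ hσ => ?_⟩
  · rintro ρ (hρ | hρ)
    · linarith [hGE _ (isState_tensorPow (hA ρ hρ) n), hI ρ hρ]
    · linarith [hGF _ (isState_tensorPow (hA' ρ hρ) n), hI' ρ hρ]
  · refine (hGB _ (isState_tensorPow (hB σ hσ) n)).trans ?_
    rw [div_mul_eq_mul_div, add_mul]
    gcongr
    · exact hII σ hσ
    · exact hII' σ hσ

lemma HasTests.le_steinExponent (hB : ∀ σ ∈ B, IsState σ) (h : HasTests A B R) (hR : R' < R) :
    (R' : EReal) ≤ steinExponent (iidSet A) (iidSet B) := by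
  refine QSanov.le_steinExponent fun ε hε => ?_
  obtain ⟨C, hC, hev⟩ := h ε hε.1
  filter_upwards [hev, eventually_le_exp_mul C (sub_pos.mpr hR)]
  rintro n ⟨E, hE, hE', hI, hII⟩ hn
  refine typeII_le ?_ hE hE' ?_ (Real.exp_pos _).le ?_
  · rintro _ ⟨σ, hσ, rfl⟩
    exact isState_tensorPow (hB σ hσ) n
  · rintro _ ⟨ρ, hρ, rfl⟩
    exact hI ρ hρ
  · rintro _ ⟨σ, hσ, rfl⟩
    refine (hII σ hσ).trans ?_
    calc C * Real.exp (-(n * R)) ≤ Real.exp (n * (R - R')) * Real.exp (-(n * R)) := by gcongr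
      _ = _ := by rw [← Real.exp_add]; ring_nf

/-- Tests that work locally around each null hypothesis combine, by compactness. -/
lemma exists_lt_hasTests_of_isCompact (hA : ∀ ρ ∈ A, IsState ρ) (hAc : IsCompact A)
    (hB : ∀ σ ∈ B, IsState σ) {S : EReal} (hS : S < ⊤)
    (h : ∀ ρ ∈ A, ∃ V ∈ 𝓝 ρ, ∃ R : ℝ, S < R ∧ HasTests (V ∩ A) B R) :
    ∃ R : ℝ, S < R ∧ HasTests A B R := by
  have key : ∃ R : ℝ, S < R ∧ HasTests (A ∩ A) B R := by
    refine hAc.induction_on (p := fun s => ∃ R : ℝ, S < R ∧ HasTests (s ∩ A) B R) ?_ ?_ ?_ ?_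
    · obtain ⟨R, hR, -⟩ := EReal.lt_iff_exists_real_btwn.mp hS
      exact ⟨R, hR, by rw [Set.empty_inter]; exact hasTests_empty B R⟩
    · rintro s t hst ⟨R, hR, ht⟩
      exact ⟨R, hR, ht.mono (Set.inter_subset_inter_left A hst) le_rfl⟩
    · rintro s t ⟨R, hR, hs⟩ ⟨R', hR', ht⟩
      refine ⟨min R R', by rcases min_choice R R' with e | e <;> rw [e] <;> assumption, ?_⟩
      rw [Set.union_inter_distrib_right]
      exact (hs.mono subset_rfl (min_le_left _ _)).union (fun ρ hρ => hA ρ hρ.2)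
        (fun ρ hρ => hA ρ hρ.2) hB (ht.mono subset_rfl (min_le_right _ _))
    · intro ρ hρ
      obtain ⟨V, hV, hR⟩ := h ρ hρ
      exact ⟨V, mem_nhdsWithin_of_mem_nhds hV, hR⟩
  rwa [Set.inter_self] at key

end HasTests

section Attainment

lemma cFrac_mul_le_of_le {n : ℕ} (hn : 0 < n) {x : EReal} {R : ℝ}
    (h : x ≤ ((n * R : ℝ) : EReal)) : cFrac n * x ≤ R := by
  have hn' : (0 : ℝ) < n := by exact_mod_cast hn
  have h0 : (0 : EReal) ≤ cFrac n := by
    rw [cFrac]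
    exact_mod_cast inv_nonneg.mpr hn'.le
  refine (mul_le_mul_of_nonneg_left h h0).trans ?_
  rw [cFrac, ← EReal.coe_mul, inv_mul_cancel_left₀ hn'.ne']

variable {ι : Type*} [Fintype ι] [DecidableEq ι] {A B : Set (MatC ι)}

lemma exists_nhds_hasTests_of_lt_limsup (hB : ∀ σ ∈ B, IsState σ) {μ : Measure ↥B}
    [IsProbabilityMeasure μ]
    (hμ : ∀ δ : ℝ, 0 < δ → ∃ C : ℝ, 0 < C ∧ ∀ n : ℕ, ∀ σ ∈ B,
      (((C * Real.exp (n * δ) : ℝ) : ℂ) • iidMix μ n - tensorPow σ n).PosSemidef)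
    {ρ : MatC ι} (hρ : IsState ρ) {R : ℝ}
    (hR : (R : EReal) <
      limsup (fun n : ℕ => cFrac n * relEnt (tensorPow ρ n) (iidMix μ n)) atTop) :
    ∃ V ∈ 𝓝 ρ, ∀ A : Set (MatC ι), (∀ τ ∈ A, IsState τ) → HasTests (V ∩ A) B R := by
  obtain ⟨R', hR', hlim⟩ := EReal.lt_iff_exists_real_btwn.mp hR
  have hRR' : R < R' := by exact_mod_cast hR'
  obtain ⟨δ, hδ, hδR⟩ : ∃ δ : ℝ, 0 < δ ∧ R + 3 * δ ≤ R' :=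
    ⟨(R' - R) / 3, by linarith, by linarith⟩
  obtain ⟨C, hC, hdom⟩ := hμ δ hδ
  obtain ⟨k, hk, hk0, hkpow, hkC⟩ :=
    ((frequently_lt_of_lt_limsup (by isBoundedDefault) hlim).and_eventually (
    (eventually_gt_atTop 0).and ((eventually_pow_le_exp 1 (Fintype.card (ι × ι)) hδ).and
      (eventually_le_exp_mul (2 * C) hδ)))).exists
  have hk0' : (0 : ℝ) < k := by exact_mod_cast hk0
  have hW := isState_iidMix hB μ k
  set c : ℝ := k * (R' - δ) with hc
  have hlog : Real.log (Finset.univ.image hW.1.1.eigenvalues).card ≤ k * δ := by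
    rcases Nat.eq_zero_or_pos (Finset.univ.image hW.1.1.eigenvalues).card with h0 | h0
    · rw [h0, Nat.cast_zero, Real.log_zero]; positivity
    · rw [Real.log_le_iff_le_exp (by exact_mod_cast h0)]
      refine le_trans ?_ hkpow
      rw [one_mul]
      exact_mod_cast card_image_eigenvalues_le hW.1.1 (permCopies_iidMix μ)
  obtain ⟨U, hU, f, hWf, hρf⟩ := exists_diag_test (c := c) (isState_tensorPow hρ k) hW (by
    by_contra hcon
    push Not at hcon
    refine absurd hk (not_lt.mpr (cFrac_mul_le_of_le hk0 (hcon.trans ?_)))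
    rw [EReal.coe_le_coe_iff, hc]
    linarith)
  have hsum : ∑ a, ((U.conjTranspose * tensorPow ρ k * U) a a).re = 1 := by
    rw [← Complex.re_sum]
    change ((U.conjTranspose * tensorPow ρ k * U).trace).re = 1
    rw [Matrix.mul_assoc, Matrix.trace_mul_comm, Matrix.mul_assoc, hU, Matrix.mul_one,
      (isState_tensorPow hρ k).2, Complex.one_re]
  set D : ℝ := C * Real.exp (k * δ) with hD
  have hD0 : 0 < D := by positivity
  have hM0 : 0 < 2 * D * Real.exp (-c) := by positivity
  obtain ⟨V, hV, hVA⟩ := exists_nhds_hasTests hB hρ hk0 hU (f := fun a => f a - c) hM0 (by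
    simp only [mul_sub, Finset.sum_sub_distrib]
    rw [← Finset.sum_mul, hsum, one_mul]
    exact sub_pos.mpr hρf) (fun σ hσ => by
    have hdiag : ∀ a, ((U.conjTranspose * tensorPow σ k * U) a a).re ≤
        D * ((U.conjTranspose * iidMix μ k * U) a a).re := fun a => by
      have h := (Complex.le_def.mp (((hdom k σ hσ).conjTranspose_mul_mul_same U).diag_nonneg
        (i := a))).1
      rw [mul_sub, sub_mul, Matrix.mul_smul, Matrix.smul_mul, Matrix.sub_apply,
        Matrix.smul_apply, Complex.sub_re, smul_eq_mul, Complex.re_ofReal_mul] at h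
      simpa using h
    calc _ ≤ ∑ a, D * ((U.conjTranspose * iidMix μ k * U) a a).re * Real.exp (f a - c) :=
          Finset.sum_le_sum fun a _ =>
            mul_le_mul_of_nonneg_right (hdiag a) (Real.exp_pos _).le
      _ = D * Real.exp (-c) *
          ∑ a, ((U.conjTranspose * iidMix μ k * U) a a).re * Real.exp (f a) := by
          rw [Finset.mul_sum]
          refine Finset.sum_congr rfl fun a _ => ?_
          rw [sub_eq_add_neg, Real.exp_add]
          ring
      _ ≤ D * Real.exp (-c) * 2 := by gcongr
      _ = _ := by ring)
  refine ⟨V, hV, fun A hA => (hVA A hA).mono subset_rfl ?_⟩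
  rw [le_div_iff₀ hk0', Real.log_mul (by positivity) (Real.exp_pos _).ne', Real.log_exp]
  have h2D : Real.log (2 * D) ≤ 2 * (k * δ) := by
    rw [Real.log_le_iff_le_exp (by positivity), two_mul (k * δ), Real.exp_add, hD, ← mul_assoc]
    gcongr
  have := mul_le_mul_of_nonneg_left hδR hk0'.le
  rw [hc]
  linarith

/-- The Stein exponent is attained as a regularized relative entropy at any universal mixture. -/
lemma exists_tendsto_relEnt_steinExponent (hA : ∀ ρ ∈ A, IsState ρ) (hAcl : IsClosed A)
    (hAne : A.Nonempty) (hB : ∀ σ ∈ B, IsState σ) {μ : Measure ↥B} [IsProbabilityMeasure μ]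
    (hμ : ∀ δ : ℝ, 0 < δ → ∃ C : ℝ, 0 < C ∧ ∀ n : ℕ, ∀ σ ∈ B,
      (((C * Real.exp (n * δ) : ℝ) : ℂ) • iidMix μ n - tensorPow σ n).PosSemidef) :
    ∃ ρ ∈ A, Tendsto (fun n : ℕ => cFrac n * relEnt (tensorPow ρ n) (iidMix μ n)) atTop
      (𝓝 (steinExponent (iidSet A) (iidSet B))) := by
  by_contra! hcon
  set S := steinExponent (iidSet A) (iidSet B) with hS
  have hlim : ∀ ρ ∈ A,
      S < limsup (fun n : ℕ => cFrac n * relEnt (tensorPow ρ n) (iidMix μ n)) atTop := by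
    intro ρ hρ
    by_contra! hle
    exact hcon ρ hρ (tendsto_of_le_liminf_of_limsup_le
      (steinExponent_le_liminf_relEnt hA hB hρ μ) hle)
  obtain ⟨ρ₀, hρ₀⟩ := hAne
  obtain ⟨R, hSR, hR⟩ := exists_lt_hasTests_of_isCompact hA
    (isCompact_of_isClosed_of_isState hAcl hA) hB ((hlim ρ₀ hρ₀).trans_le le_top) (fun ρ hρ => by
      obtain ⟨R, hSR, hR⟩ := EReal.lt_iff_exists_real_btwn.mp (hlim ρ hρ)
      obtain ⟨V, hV, hVA⟩ := exists_nhds_hasTests_of_lt_limsup hB hμ (hA ρ hρ) hR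
      exact ⟨V, hV, R, hSR, hVA A hA⟩)
  obtain ⟨R', hSR', hR'⟩ := EReal.lt_iff_exists_real_btwn.mp hSR
  exact absurd (hR.le_steinExponent hB (EReal.coe_lt_coe_iff.mp hR')) (not_le.mpr hSR')

end Attainment

/-- **Equality of Stein exponents for i.i.d. and arbitrarily varying alternatives with
convex base set.**
`Stein(𝒜₁^{iid}‖ℬ₁^{iid}) = Stein(𝒜₁^{iid}‖ℬ₁^{av})
  = min*_{ρ∈𝒜₁, μ∈𝒫(ℬ₁)} lim_n (1/n) D(ρ^{⊗n}‖∫dμ(σ) σ^{⊗n})`. -/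
theorem stein_iid_eq_av_convex_base (d : ℕ)
    (A1 B1 : Set (MatC (Fin d)))
    (hA_states : ∀ ρ ∈ A1, IsState ρ) (hA_ne : A1.Nonempty) (hA_closed : IsClosed A1)
    (hB_states : ∀ σ ∈ B1, IsState σ) (hB_ne : B1.Nonempty) (hB_closed : IsClosed B1)
    (hB_convex : Convex ℝ B1) :
    ∃ S : EReal,
      steinExponent (iidSet A1) (iidSet B1) = S ∧
      steinExponent (iidSet A1) (avSet B1) = S ∧
      (∃ ρ ∈ A1, ∃ μ : Measure ↥B1, IsProbabilityMeasure μ ∧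
        Filter.Tendsto (fun n : ℕ => cFrac n * relEnt (tensorPow ρ n) (iidMix μ n))
          Filter.atTop (nhds S)) ∧
      (∀ ρ ∈ A1, ∀ μ : Measure ↥B1, IsProbabilityMeasure μ → ∀ L : EReal,
        Filter.Tendsto (fun n : ℕ => cFrac n * relEnt (tensorPow ρ n) (iidMix μ n))
          Filter.atTop (nhds L) → S ≤ L) := by
  obtain ⟨μ, hμp, hμ⟩ := exists_universal_measure hB_states hB_ne hB_closed hB_convex
  obtain ⟨ρ, hρ, hlim⟩ :=
    exists_tendsto_relEnt_steinExponent hA_states hA_closed hA_ne hB_states hμ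
  refine ⟨_, rfl, steinExponent_avSet_eq_iidSet hB_states hB_ne hB_closed hB_convex,
    ⟨ρ, hρ, μ, hμp, hlim⟩, fun ρ' hρ' μ' _ L hL => ?_⟩
  rw [← hL.liminf_eq]
  exact steinExponent_le_liminf_relEnt hA_states hB_states hρ' μ'

end QSanov
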